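/- arXiv:2007.05529 — 14 statements merged into one kernel-verified Lean document; each statement's English description precedes it below -/
import Mathlib

section
/- Let γ > 1, r > 0 and ρ ≥ γr, and let F : [0,∞) → ℝ be continuous and nonincreasing with F(0) = 0, F(y) ≤ 0 for all y ≥ 0, and F(y) ≥ −c(y + y^γ) for all y ≥ 0, for some constant c > 0. Then the face-lifted reward satisfies F̄(y₀) = 0 for every y₀ ≥ 0. -/
open MeasureTheory Real Set

/-- The deterministic state `y^{y₀,p}(t) = e^{rt} y₀ - r ∫₀^t e^{r(t-s)} p(s) ds`,
solution of `y(0) = y₀`, `y'(t) = r (y(t) - p(t))`. -/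
noncomputable def ypath (r y₀ : ℝ) (p : ℝ → ℝ) (t : ℝ) : ℝ :=
  Real.exp (r * t) * y₀ - r * ∫ s in (0:ℝ)..t, Real.exp (r * (t - s)) * p s

/-- A pair `(p, T)` is admissible for the initial condition `y₀` if `p` is a nonnegative
Borel map with `t ↦ e^{-rt} p(t)` locally integrable, `T ≥ 0`, and the associated state
stays nonnegative on `[0, T]`. -/
def Admissible (r y₀ : ℝ) (p : ℝ → ℝ) (T : ℝ) : Prop :=
  Measurable p ∧ (∀ t, 0 ≤ p t) ∧
    LocallyIntegrableOn (fun t => Real.exp (-(r * t)) * p t) (Set.Ici 0) ∧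
    0 ≤ T ∧ ∀ t ∈ Set.Icc 0 T, 0 ≤ ypath r y₀ p t

/-- The face-lifted reward `F̄(y₀)`, supremum over admissible `(p, T)` of
`e^{-ρT} F(y^{y₀,p}(T)) + ∫₀^T ρ e^{-ρt} F(p(t)) dt`. -/
noncomputable def facelift (r ρ : ℝ) (F : ℝ → ℝ) (y₀ : ℝ) : ℝ :=
  sSup { v | ∃ p T, Admissible r y₀ p T ∧
    v = Real.exp (-(ρ * T)) * F (ypath r y₀ p T)
        + ∫ t in (0:ℝ)..T, ρ * Real.exp (-(ρ * t)) * F (p t) }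

lemma integral_exp_neg_mul_le {a : ℝ} (ha : 0 < a) (T : ℝ) :
    ∫ t in (0:ℝ)..T, Real.exp (-(a * t)) ≤ 1 / a := by
  have hderiv : ∀ t ∈ uIcc 0 T,
      HasDerivAt (fun t => -(1 / a) * Real.exp (-(a * t))) (Real.exp (-(a * t))) t := by
    intro t _
    have h := ((((hasDerivAt_id t).const_mul a).neg).exp).const_mul (-(1 / a))
    refine h.congr_deriv ?_
    simp only [id, Pi.neg_apply]
    field_simp
  rw [intervalIntegral.integral_eq_sub_of_hasDerivAt hderiv
    (Continuous.intervalIntegrable (by fun_prop) _ _)]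
  have : 0 < 1 / a * Real.exp (-(a * T)) := by positivity
  simp only [mul_zero, neg_zero, Real.exp_zero]
  linarith

/-- The state stays proportional to `e^{rt}` times an affine function when the payment rate
grows like `e^{rt}`. -/
lemma ypath_exp (r y₀ q t : ℝ) :
    ypath r y₀ (fun s => Real.exp (r * s) * q) t = Real.exp (r * t) * (y₀ - r * q * t) := by
  have h : ∀ s, Real.exp (r * (t - s)) * (Real.exp (r * s) * q) = Real.exp (r * t) * q := by
    intro s
    rw [← mul_assoc, ← Real.exp_add]
    ring_nf
  simp only [ypath, h, intervalIntegral.integral_const, smul_eq_mul]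
  ring

lemma admissible_exp {r y₀ q T : ℝ} (hr : 0 < r) (hq : 0 ≤ q) (hT : 0 ≤ T)
    (h : r * q * T ≤ y₀) : Admissible r y₀ (fun s => Real.exp (r * s) * q) T := by
  refine ⟨by fun_prop, fun t => by positivity, ?_, hT, fun t ht => ?_⟩
  · exact ((by fun_prop : Continuous fun t =>
      Real.exp (-(r * t)) * (Real.exp (r * t) * q)).locallyIntegrable).locallyIntegrableOn _
  · rw [ypath_exp]
    have : r * q * t ≤ r * q * T := mul_le_mul_of_nonneg_left ht.2 (by positivity)
    exact mul_nonneg (Real.exp_pos _).le (by linarith)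

lemma reward_nonpos {r ρ y₀ T : ℝ} {p F : ℝ → ℝ} (hρ : 0 ≤ ρ)
    (hFnonpos : ∀ y, 0 ≤ y → F y ≤ 0) (hp : Admissible r y₀ p T) :
    Real.exp (-(ρ * T)) * F (ypath r y₀ p T)
      + ∫ t in (0:ℝ)..T, ρ * Real.exp (-(ρ * t)) * F (p t) ≤ 0 := by
  obtain ⟨-, hp0, -, hT, hy⟩ := hp
  have h1 : Real.exp (-(ρ * T)) * F (ypath r y₀ p T) ≤ 0 :=
    mul_nonpos_of_nonneg_of_nonpos (Real.exp_pos _).le (hFnonpos _ (hy T ⟨hT, le_rfl⟩))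
  have h2 : ∫ t in (0:ℝ)..T, ρ * Real.exp (-(ρ * t)) * F (p t) ≤ 0 := by
    rw [intervalIntegral.integral_of_le hT]
    exact integral_nonpos fun t =>
      mul_nonpos_of_nonneg_of_nonpos (by positivity) (hFnonpos _ (hp0 t))
  linarith

lemma le_integral_reward_exp {γ r ρ c q T : ℝ} {F : ℝ → ℝ} (hγ : 1 < γ) (hr : 0 < r)
    (hρ : γ * r ≤ ρ) (hFcont : ContinuousOn F (Ici 0)) (hc : 0 < c)
    (hFlb : ∀ y, 0 ≤ y → -c * (y + y ^ γ) ≤ F y) (hq : 0 ≤ q) (hT : 0 ≤ T) :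
    -(c * ρ) * (q * (1 / (ρ - r)) + T * q ^ γ) ≤
      ∫ t in (0:ℝ)..T, ρ * Real.exp (-(ρ * t)) * F (Real.exp (r * t) * q) := by
  have hρr : 0 < ρ - r := by nlinarith
  have hρ0 : 0 < ρ := by linarith
  have hFp : Continuous fun t => F (Real.exp (r * t) * q) :=
    hFcont.comp_continuous (by fun_prop) fun t => mem_Ici.2 (by positivity)
  have hbound : ∀ t ∈ Icc 0 T, -(c * ρ) * (q * Real.exp (-((ρ - r) * t)) + q ^ γ) ≤
      ρ * Real.exp (-(ρ * t)) * F (Real.exp (r * t) * q) := by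
    intro t ht
    have h1 := mul_le_mul_of_nonneg_left (hFlb (Real.exp (r * t) * q) (by positivity))
      (by positivity : 0 ≤ ρ * Real.exp (-(ρ * t)))
    refine le_trans ?_ h1
    have h2 : Real.exp (-(ρ * t)) * Real.exp (r * t) = Real.exp (-((ρ - r) * t)) := by
      rw [← Real.exp_add]
      ring_nf
    have h3 : Real.exp (-(ρ * t)) * (Real.exp (r * t) * q) ^ γ ≤ q ^ γ := by
      rw [Real.mul_rpow (Real.exp_pos _).le hq, ← Real.exp_mul, ← mul_assoc, ← Real.exp_add]
      refine mul_le_of_le_one_left (by positivity) (Real.exp_le_one_iff.2 ?_)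
      nlinarith [mul_le_mul_of_nonneg_right hρ ht.1]
    have h4 := mul_le_mul_of_nonneg_left h3 (by positivity : 0 ≤ c * ρ)
    rw [← h2]
    linarith
  refine le_trans ?_ (intervalIntegral.integral_mono_on hT
    (Continuous.intervalIntegrable (by fun_prop) _ _)
    ((Continuous.mul (by fun_prop) hFp).intervalIntegrable _ _) hbound)
  rw [intervalIntegral.integral_const_mul, intervalIntegral.integral_add
    (Continuous.intervalIntegrable (by fun_prop) _ _) (by simp),
    intervalIntegral.integral_const_mul, intervalIntegral.integral_const]
  simp only [sub_zero, smul_eq_mul]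
  have h5 := mul_le_mul_of_nonneg_left (integral_exp_neg_mul_le hρr T) hq
  have h6 : 0 < c * ρ := by positivity
  exact mul_le_mul_of_nonpos_left (by linarith) (by linarith)

lemma tendsto_mul_div_rpow_atTop {A γ : ℝ} (hA : 0 ≤ A) (hγ : 1 < γ) :
    Filter.Tendsto (fun T : ℝ => T * (A / T) ^ γ) Filter.atTop (nhds 0) := by
  have h := (tendsto_rpow_neg_atTop (sub_pos.2 hγ)).const_mul (A ^ γ)
  rw [mul_zero] at h
  refine h.congr' ?_
  filter_upwards [Filter.eventually_gt_atTop 0] with T hT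
  rw [Real.div_rpow hA hT.le, neg_sub, Real.rpow_sub hT, Real.rpow_one]
  ring

/-- If `ρ ≥ γ r`, a very impatient principal can reduce her loss to zero: the
face-lifted reward vanishes identically. -/
theorem facelift_eq_zero_of_very_impatient
    (γ r ρ c : ℝ) (hγ : 1 < γ) (hr : 0 < r) (hρ : γ * r ≤ ρ)
    (F : ℝ → ℝ) (hFcont : ContinuousOn F (Set.Ici 0))
    (hFanti : AntitoneOn F (Set.Ici 0)) (hF0 : F 0 = 0)
    (hFnonpos : ∀ y, 0 ≤ y → F y ≤ 0) (hc : 0 < c)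
    (hFlb : ∀ y, 0 ≤ y → -c * (y + y ^ γ) ≤ F y) :
    ∀ y₀, 0 ≤ y₀ → facelift r ρ F y₀ = 0 := by
  intro y₀ hy₀
  have hρ0 : 0 ≤ ρ := by nlinarith
  have hub : ∀ v ∈ { v | ∃ p T, Admissible r y₀ p T ∧
      v = Real.exp (-(ρ * T)) * F (ypath r y₀ p T)
        + ∫ t in (0:ℝ)..T, ρ * Real.exp (-(ρ * t)) * F (p t) }, v ≤ 0 := by
    rintro v ⟨p, T, hp, rfl⟩
    exact reward_nonpos hρ0 hFnonpos hp
  refine le_antisymm (Real.sSup_nonpos hub) ?_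
  have hlim : Filter.Tendsto (fun T : ℝ => -(c * ρ) *
      (y₀ / r / T * (1 / (ρ - r)) + T * (y₀ / r / T) ^ γ)) Filter.atTop (nhds 0) := by
    have h1 : Filter.Tendsto (fun T : ℝ => y₀ / r / T) Filter.atTop (nhds 0) :=
      Filter.Tendsto.const_div_atTop Filter.tendsto_id _
    simpa using ((h1.mul_const (1 / (ρ - r))).add
      (tendsto_mul_div_rpow_atTop (by positivity : 0 ≤ y₀ / r) hγ)).const_mul (-(c * ρ))
  refine le_of_tendsto hlim ?_
  filter_upwards [Filter.eventually_gt_atTop 0] with T hT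
  have hq : 0 ≤ y₀ / r / T := by positivity
  have hqT : r * (y₀ / r / T) * T = y₀ := by field_simp
  refine (le_integral_reward_exp hγ hr hρ hFcont hc hFlb hq hT.le).trans
    (le_csSup ⟨0, hub⟩ ⟨_, T, admissible_exp hr hq hT.le hqT.le, ?_⟩)
  rw [ypath_exp, hqT, sub_self, mul_zero, hF0, mul_zero, zero_add]
end

section
/- Let γ > 1 and δ > 1/γ, and let F^⋆(q) := inf_{x ≥ 0}{xq + x^γ} be the concave conjugate of F(y) = −y^γ. Define K := ((δγ−1)/(γ−1))^{γ−1}·δ^{−γ} and w(y) := −K y^γ for y ≥ 0. Then w satisfies the face-lift ordinary differential equation w(y) − δy w′(y) + F^⋆(δw′(y)) = 0 for every y ≥ 0. -/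
open Real Set

lemma mul_rpow_sub_one {s p : ℝ} (hs : 0 ≤ s) (hp : 1 < p) : s * s ^ (p - 1) = s ^ p := by
  rcases hs.eq_or_lt with rfl | hs
  · simp [Real.zero_rpow (by linarith : p ≠ 0)]
  · rw [Real.rpow_sub_one hs.ne']
    field_simp

/-- The convex function `x ↦ x ^ p` lies above its tangent line at `s`. -/
lemma tangent_le_rpow {x s p : ℝ} (hx : 0 ≤ x) (hs : 0 ≤ s) (hp : 1 < p) :
    (1 - p) * s ^ p ≤ x * (-(p * s ^ (p - 1))) + x ^ p := by
  have hp1 : p - 1 ≠ 0 := by linarith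
  have hp0 : 0 < p := by linarith
  have hY := Real.young_inequality_of_nonneg hx (Real.rpow_nonneg hs (p - 1))
    (Real.HolderConjugate.conjExponent hp)
  have hpow : (s ^ (p - 1)) ^ p.conjExponent = s ^ p := by
    rw [← Real.rpow_mul hs, Real.conjExponent, mul_div_cancel₀ _ hp1]
  rw [hpow, Real.conjExponent] at hY
  have hmul := mul_le_mul_of_nonneg_left hY hp0.le
  have hrhs : p * (x ^ p / p + s ^ p / (p / (p - 1))) = x ^ p + (p - 1) * s ^ p := by
    field_simp
  linarith

/-- The infimum defining the concave conjugate of `-x ^ p` at the slope `-p s ^ (p - 1)`. -/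
lemma sInf_mul_add_rpow {s p : ℝ} (hs : 0 ≤ s) (hp : 1 < p) :
    sInf {v : ℝ | ∃ x, 0 ≤ x ∧ v = x * (-(p * s ^ (p - 1))) + x ^ p} = (1 - p) * s ^ p := by
  refine IsLeast.csInf_eq ⟨⟨s, hs, ?_⟩, ?_⟩
  · linear_combination p * mul_rpow_sub_one hs hp
  · rintro v ⟨x, hx, rfl⟩
    exact tangent_le_rpow hx hs hp

/-- With `F(y) = -y^γ` and its concave conjugate
`F^⋆(q) = inf_{x ≥ 0} {x q + x^γ}`, for `γ > 1` and `δ > 1/γ` the function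
`w(y) = -K y^γ`, with `K = ((δγ-1)/(γ-1))^{γ-1} δ^{-γ}`, satisfies the face-lift
ODE `w(y) - δ y w'(y) + F^⋆(δ w'(y)) = 0` for every `y ≥ 0`
(where `w'(y) = -K γ y^{γ-1}` is the derivative of `w` on `[0,∞)`). -/
theorem power_solution_of_facelift_ODE
    (γ δ K : ℝ) (hγ : 1 < γ) (hδ : 1 / γ < δ)
    (hK : K = ((δ * γ - 1) / (γ - 1)) ^ (γ - 1) * δ ^ (-γ)) :
    ∀ y, 0 ≤ y →
      HasDerivWithinAt (fun z : ℝ => -K * z ^ γ) (-(K * γ) * y ^ (γ - 1)) (Set.Ici 0) y ∧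
      -K * y ^ γ - δ * y * (-(K * γ) * y ^ (γ - 1))
          + sInf { v : ℝ | ∃ x, 0 ≤ x ∧
              v = x * (δ * (-(K * γ) * y ^ (γ - 1))) + x ^ γ } = 0 := by
  intro y hy
  have hγ1 : 0 < γ - 1 := by linarith
  have hδ0 : 0 < δ := (by positivity : (0 : ℝ) < 1 / γ).trans hδ
  have ha : 0 < (δ * γ - 1) / (γ - 1) := by
    have := (div_lt_iff₀ (by linarith : 0 < γ)).1 hδ
    exact div_pos (by linarith) hγ1
  have ha' : (γ - 1) * ((δ * γ - 1) / (γ - 1)) = δ * γ - 1 := by field_simp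
  set a := (δ * γ - 1) / (γ - 1)
  have hc : 0 ≤ a / δ := by positivity
  have hKa : a * K = (a / δ) ^ γ := by
    rw [hK, ← mul_assoc, mul_rpow_sub_one ha.le hγ, Real.div_rpow ha.le hδ0.le,
      Real.rpow_neg hδ0.le, div_eq_mul_inv]
  have hδK : δ * K = (a / δ) ^ (γ - 1) := by
    rw [Real.rpow_sub_one (by positivity), ← hKa]
    field_simp
  refine ⟨?_, ?_⟩
  · have h := (Real.hasDerivAt_rpow_const (x := y) (Or.inr hγ.le)).const_mul (-K)
    exact (h.congr_deriv (by ring)).hasDerivWithinAt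
  · have hslope : δ * (-(K * γ) * y ^ (γ - 1)) = -(γ * (a / δ * y) ^ (γ - 1)) := by
      rw [Real.mul_rpow hc hy, ← hδK]
      ring
    rw [hslope, sInf_mul_add_rpow (by positivity) hγ, Real.mul_rpow hc hy, ← hKa]
    linear_combination δ * K * γ * mul_rpow_sub_one hy hγ - K * y ^ γ * ha'
end

section
/- (i) Let 0 < δ < 1, C > 0 and γ′ ≥ 1 with γ′(1−δ) < 1, and let F^⋆ : (−∞,0] → ℝ be continuous with |F^⋆(x)| ≤ C(1+|x|^{γ′}) for all x ≤ 0. Then for every p < 0 the integral I(p) := ∫_{−∞}^{p} F^⋆(δx)·(−x)^{−1−1/(1−δ)} dx converges absolutely, the function w^⋆(p) := (1−δ)^{−1}(−p)^{1/(1−δ)} I(p) is differentiable on (−∞,0), and it satisfies the linear ODE −w^⋆(p) + (1−δ)p(w^⋆)′(p) + F^⋆(δp) = 0 for all p < 0. (ii) Let δ > 1, f < 0, and F^⋆ : (−∞,0] → ℝ continuous; then w^⋆(p) := (1−δ)^{−1}(−p)^{1/(1−δ)} ∫_{f}^{p} F^⋆(δx)·(−x)^{−1−1/(1−δ)} dx,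 defined for p ≤ f, satisfies w^⋆(f) = 0 and the same linear ODE −w^⋆(p) + (1−δ)p(w^⋆)′(p) + F^⋆(δp) = 0 for all p < f. -/
open MeasureTheory Real Set intervalIntegral

theorem integrableOn_Iic_neg_rpow {s p : ℝ} (hs : s < -1) (hp : p < 0) :
    IntegrableOn (fun x : ℝ => (-x) ^ s) (Iic p) := by
  have h := integrableOn_Ioi_rpow_of_lt hs (neg_pos.mpr hp)
  rw [← integrableOn_Ici_iff_integrableOn_Ioi] at h
  exact h.comp_neg_Iic

theorem continuousOn_comp_mul_mul_neg_rpow {F : ℝ → ℝ} (hF : ContinuousOn F (Iic 0)) {δ : ℝ}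
    (hδ : 0 < δ) (s : ℝ) : ContinuousOn (fun x => F (δ * x) * (-x) ^ s) (Iio 0) := by
  refine ContinuousOn.mul (hF.comp (by fun_prop) fun x hx => ?_)
    (ContinuousOn.rpow_const (by fun_prop) fun x hx => Or.inl (neg_pos.mpr hx).ne')
  exact mul_nonpos_of_nonneg_of_nonpos hδ.le (le_of_lt hx)

theorem hasDerivAt_integral_of_continuousOn_Iio {g : ℝ → ℝ} (hg : ContinuousOn g (Iio 0))
    {a p : ℝ} (ha : a < 0) (hp : p < 0) : HasDerivAt (fun x => ∫ t in a..x, g t) (g p) p := by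
  have hnhds : Iio (0 : ℝ) ∈ nhds p := Iio_mem_nhds hp
  refine integral_hasDerivAt_right (hg.mono fun x hx => ?_).intervalIntegrable
    (hg.stronglyMeasurableAtFilter isOpen_Iio p hp) (hg.continuousAt hnhds)
  exact lt_of_le_of_lt hx.2 (max_lt ha hp)

theorem hasDerivAt_integral_Iic_of_continuousOn_Iio {g : ℝ → ℝ} (hg : ContinuousOn g (Iio 0))
    (hint : ∀ q < 0, IntegrableOn g (Iic q)) {p : ℝ} (hp : p < 0) :
    HasDerivAt (fun x => ∫ t in Iic x, g t) (g p) p := by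
  refine ((hasDerivAt_integral_of_continuousOn_Iio hg hp hp).const_add
    (∫ t in Iic p, g t)).congr_of_eventuallyEq ?_
  filter_upwards [Iio_mem_nhds hp] with x hx
  rw [← integral_Iic_sub_Iic (hint p hp) (hint x hx)]
  ring

theorem integrableOn_Iic_comp_mul_mul_neg_rpow {F : ℝ → ℝ} (hF : ContinuousOn F (Iic 0))
    {δ C γ s p : ℝ} (hδ : 0 < δ) (hs : s < -1) (hγs : γ + s < -1)
    (hbound : ∀ x ≤ (0 : ℝ), |F x| ≤ C * (1 + |x| ^ γ)) (hp : p < 0) :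
    IntegrableOn (fun x => F (δ * x) * (-x) ^ s) (Iic p) := by
  have hmaj : IntegrableOn (fun x : ℝ => C * (-x) ^ s + C * δ ^ γ * (-x) ^ (γ + s)) (Iic p) :=
    ((integrableOn_Iic_neg_rpow hs hp).const_mul C).add
      ((integrableOn_Iic_neg_rpow hγs hp).const_mul (C * δ ^ γ))
  refine Integrable.mono' hmaj
    (((continuousOn_comp_mul_mul_neg_rpow hF hδ s).mono
      fun x hx => lt_of_le_of_lt hx hp).aestronglyMeasurable measurableSet_Iic) ?_
  filter_upwards [ae_restrict_mem measurableSet_Iic] with x hx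
  have hx0 : 0 < -x := neg_pos.mpr (lt_of_le_of_lt hx hp)
  have hle : δ * x ≤ 0 := mul_nonpos_of_nonneg_of_nonpos hδ.le (by linarith)
  have habs : |δ * x| = δ * -x := by rw [abs_of_nonpos hle, mul_neg]
  have hb := hbound _ hle
  rw [habs, mul_rpow hδ.le hx0.le] at hb
  rw [norm_mul, norm_eq_abs, norm_eq_abs, abs_of_nonneg (rpow_nonneg hx0.le s),
    rpow_add hx0]
  calc |F (δ * x)| * (-x) ^ s ≤ C * (1 + δ ^ γ * (-x) ^ γ) * (-x) ^ s := by gcongr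
    _ = _ := by ring

/-- If `J' = F (δ ·) (-·) ^ (-1 - 1 / (1 - δ))` at `p`, then
`(1 - δ)⁻¹ (-·) ^ (1 / (1 - δ)) J` solves the dual face-lift ODE at `p`. -/
theorem dual_facelift_ODE_of_hasDerivAt {δ p : ℝ} {F J : ℝ → ℝ} (hδ : δ ≠ 1) (hp : p < 0)
    (hJ : HasDerivAt J (F (δ * p) * (-p) ^ (-1 - 1 / (1 - δ))) p) :
    DifferentiableAt ℝ (fun q => (1 - δ)⁻¹ * (-q) ^ ((1 : ℝ) / (1 - δ)) * J q) p ∧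
      -((1 - δ)⁻¹ * (-p) ^ ((1 : ℝ) / (1 - δ)) * J p)
        + (1 - δ) * p * deriv (fun q => (1 - δ)⁻¹ * (-q) ^ ((1 : ℝ) / (1 - δ)) * J q) p
        + F (δ * p) = 0 := by
  have hp0 : 0 < -p := neg_pos.mpr hp
  have hw := ((((hasDerivAt_neg p).rpow_const (p := 1 / (1 - δ)) (Or.inl hp0.ne')).const_mul
    (1 - δ)⁻¹).mul hJ)
  refine ⟨hw.differentiableAt, ?_⟩
  have hd : 1 - δ ≠ 0 := sub_ne_zero.mpr hδ.symm
  have hpow : (-p) ^ (1 / (1 - δ)) * (-p) ^ (-1 - 1 / (1 - δ)) = (-p)⁻¹ := by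
    rw [← rpow_add hp0, ← rpow_neg_one]
    congr 1
    ring
  have hpow' : (-p) ^ (1 / (1 - δ) - 1) = (-p) ^ (1 / (1 - δ)) * (-p)⁻¹ := by
    rw [rpow_sub_one hp0.ne', div_eq_mul_inv]
  have hderiv : deriv (fun q => (1 - δ)⁻¹ * (-q) ^ ((1 : ℝ) / (1 - δ)) * J q) p =
      (1 - δ)⁻¹ * (-1 * (1 / (1 - δ)) * ((-p) ^ (1 / (1 - δ)) * (-p)⁻¹)) * J p +
        (1 - δ)⁻¹ * F (δ * p) * (-p)⁻¹ := by
    rw [← hpow', ← hpow]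
    refine hw.deriv.trans ?_
    ring
  rw [hderiv]
  have hpne : p ≠ 0 := hp.ne
  field_simp
  ring

/-- Explicit solutions of the dual face-lift linear ODE
`-w^⋆(p) + (1-δ) p (w^⋆)'(p) + F^⋆(δp) = 0`.

(i) For `0 < δ < 1`, `C > 0`, `γ' ≥ 1` with `γ'(1-δ) < 1` and `F^⋆` continuous on
`(-∞,0]` with `|F^⋆(x)| ≤ C(1+|x|^{γ'})`, the integral
`I(p) = ∫_{-∞}^p F^⋆(δx)(-x)^{-1-1/(1-δ)} dx` converges absolutely for every `p < 0`,
and `w^⋆(p) = (1-δ)⁻¹ (-p)^{1/(1-δ)} I(p)` is differentiable and solves the ODE on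
`(-∞,0)`.

(ii) For `δ > 1`, `f < 0` and `F^⋆` continuous on `(-∞,0]`, the function
`w^⋆(p) = (1-δ)⁻¹ (-p)^{1/(1-δ)} ∫_f^p F^⋆(δx)(-x)^{-1-1/(1-δ)} dx` vanishes at `f`
and solves the same ODE for every `p < f`. -/
theorem dual_facelift_ODE_solutions :
    (∀ (δ C γ' : ℝ) (Fs : ℝ → ℝ), 0 < δ → δ < 1 → 0 < C → 1 ≤ γ' → γ' * (1 - δ) < 1 →
      ContinuousOn Fs (Set.Iic 0) →
      (∀ x, x ≤ (0:ℝ) → |Fs x| ≤ C * (1 + |x| ^ γ')) →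
      ∀ p, p < (0:ℝ) →
        MeasureTheory.IntegrableOn
          (fun x => Fs (δ * x) * (-x) ^ (-1 - 1 / (1 - δ))) (Set.Iic p) ∧
        DifferentiableAt ℝ
          (fun p' => (1 - δ)⁻¹ * (-p') ^ ((1:ℝ) / (1 - δ)) *
            ∫ x in Set.Iic p', Fs (δ * x) * (-x) ^ (-1 - 1 / (1 - δ))) p ∧
        -((1 - δ)⁻¹ * (-p) ^ ((1:ℝ) / (1 - δ)) *
              ∫ x in Set.Iic p, Fs (δ * x) * (-x) ^ (-1 - 1 / (1 - δ)))
          + (1 - δ) * p *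
            deriv (fun p' => (1 - δ)⁻¹ * (-p') ^ ((1:ℝ) / (1 - δ)) *
              ∫ x in Set.Iic p', Fs (δ * x) * (-x) ^ (-1 - 1 / (1 - δ))) p
          + Fs (δ * p) = 0) ∧
    (∀ (δ f : ℝ) (Fs : ℝ → ℝ), 1 < δ → f < 0 → ContinuousOn Fs (Set.Iic 0) →
      ((1 - δ)⁻¹ * (-f) ^ ((1:ℝ) / (1 - δ)) *
          ∫ x in f..f, Fs (δ * x) * (-x) ^ (-1 - 1 / (1 - δ))) = 0 ∧
      ∀ p, p < f →
        DifferentiableAt ℝ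
          (fun p' => (1 - δ)⁻¹ * (-p') ^ ((1:ℝ) / (1 - δ)) *
            ∫ x in f..p', Fs (δ * x) * (-x) ^ (-1 - 1 / (1 - δ))) p ∧
        -((1 - δ)⁻¹ * (-p) ^ ((1:ℝ) / (1 - δ)) *
              ∫ x in f..p, Fs (δ * x) * (-x) ^ (-1 - 1 / (1 - δ)))
          + (1 - δ) * p *
            deriv (fun p' => (1 - δ)⁻¹ * (-p') ^ ((1:ℝ) / (1 - δ)) *
              ∫ x in f..p', Fs (δ * x) * (-x) ^ (-1 - 1 / (1 - δ))) p
          + Fs (δ * p) = 0) := by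
  refine ⟨?_, ?_⟩
  · intro δ C γ' Fs hδ0 hδ1 _ _ hγδ hF hbound p hp
    have hd : 0 < 1 - δ := sub_pos.mpr hδ1
    have hpos : 0 < 1 / (1 - δ) := one_div_pos.mpr hd
    have hγ : γ' < 1 / (1 - δ) := (lt_div_iff₀ hd).mpr hγδ
    have hint : ∀ q < 0, IntegrableOn
        (fun x => Fs (δ * x) * (-x) ^ (-1 - 1 / (1 - δ))) (Iic q) := fun q hq =>
      integrableOn_Iic_comp_mul_mul_neg_rpow hF hδ0 (by linarith) (by linarith) hbound hq
    exact ⟨hint p hp, dual_facelift_ODE_of_hasDerivAt hδ1.ne hp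
      (hasDerivAt_integral_Iic_of_continuousOn_Iio
        (continuousOn_comp_mul_mul_neg_rpow hF hδ0 _) hint hp)⟩
  · intro δ f Fs hδ hf hF
    refine ⟨by rw [integral_same, mul_zero], fun p hp => ?_⟩
    exact dual_facelift_ODE_of_hasDerivAt hδ.ne' (hp.trans hf)
      (hasDerivAt_integral_of_continuousOn_Iio
        (continuousOn_comp_mul_mul_neg_rpow hF (by linarith) _) hf (hp.trans hf))
end

section
/- Let δ > 1 and p₀ < 0. Let F^⋆ : ℝ → ℝ be concave, differentiable and nondecreasing, with F^⋆(q) = 0 for all q ≥ p₀ and F^⋆ strictly concave on (−∞,p₀]. Set f_δ := p₀/δ (so p₀ < f_δ < 0). Let w^⋆ : (−∞,f_δ] → ℝ be continuous, continuously differentiable on (−∞,f_δ), satisfy −w^⋆(q) + (1−δ)q(w^⋆)′(q) + F^⋆(δq) = 0 for all q < f_δ, and w^⋆(f_δ) = 0. Then w^⋆(q) ≤ F^⋆(q) for all q ≤ f_δ, w^⋆ is strictly concave, and w^⋆ is strictly increasing on (−∞,f_δ]. -/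
open Real Set

section WeightedGrowth

variable {a f b : ℝ} {y y' : ℝ → ℝ}

lemma hasDerivAt_mul_neg_rpow {q d : ℝ} (hq : q < 0) (hy : HasDerivAt y d q) :
    HasDerivAt (fun x => y x * (-x) ^ b) ((-q) ^ (b - 1) * (-q * d - b * y q)) q := by
  have hpos : 0 < -q := neg_pos.2 hq
  have hpow := (hasDerivAt_neg q).rpow_const (p := b) (Or.inl hpos.ne')
  refine (hy.mul hpow).congr_deriv ?_
  have hsplit : (-q) ^ b = (-q) ^ (b - 1) * (-q) := by
    rw [← Real.rpow_add_one hpos.ne', sub_add_cancel]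
  rw [hsplit]
  ring

lemma continuousOn_mul_neg_rpow (hf : f < 0) (hy : ContinuousOn y (Set.Icc a f)) :
    ContinuousOn (fun x => y x * (-x) ^ b) (Set.Icc a f) :=
  hy.mul (continuousOn_id.neg.rpow_const fun _ hx =>
    Or.inl (neg_pos.2 (hx.2.trans_lt hf)).ne')

/-- If `b y < -q y'` on `(a, f)` with `f < 0`, then `y * (-q) ^ b` increases strictly from
`a` to `f`, so `y a` is negative as soon as `y f ≤ 0`. -/
lemma neg_of_mul_lt_neg_mul_deriv (hf : f < 0) (haf : a < f)
    (hy : ContinuousOn y (Set.Icc a f)) (hy' : ∀ q ∈ Set.Ioo a f, HasDerivAt y (y' q) q)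
    (hlt : ∀ q ∈ Set.Ioo a f, b * y q < -q * y' q) (hyf : y f ≤ 0) : y a < 0 := by
  have hmono : StrictMonoOn (fun x => y x * (-x) ^ b) (Set.Icc a f) := by
    refine strictMonoOn_of_deriv_pos (convex_Icc a f) (continuousOn_mul_neg_rpow hf hy) ?_
    rw [interior_Icc]
    intro q hq
    have hq0 : q < 0 := hq.2.trans hf
    rw [(hasDerivAt_mul_neg_rpow hq0 (hy' q hq)).deriv]
    exact mul_pos (Real.rpow_pos_of_pos (neg_pos.2 hq0) _) (sub_pos.2 (hlt q hq))
  have hval : y a * (-a) ^ b < y f * (-f) ^ b :=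
    hmono (Set.left_mem_Icc.2 haf.le) (Set.right_mem_Icc.2 haf.le) haf
  have hle : y f * (-f) ^ b ≤ 0 :=
    mul_nonpos_of_nonpos_of_nonneg hyf (Real.rpow_nonneg (neg_pos.2 hf).le _)
  exact neg_of_mul_neg_left (hval.trans_le hle)
    (Real.rpow_nonneg (neg_pos.2 (haf.trans hf)).le _)

/-- Non-strict counterpart of `neg_of_mul_lt_neg_mul_deriv`. -/
lemma nonpos_of_mul_le_neg_mul_deriv (hf : f < 0) (haf : a ≤ f)
    (hy : ContinuousOn y (Set.Icc a f)) (hy' : ∀ q ∈ Set.Ioo a f, HasDerivAt y (y' q) q)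
    (hle : ∀ q ∈ Set.Ioo a f, b * y q ≤ -q * y' q) (hyf : y f ≤ 0) : y a ≤ 0 := by
  have hderiv : ∀ q ∈ Set.Ioo a f, HasDerivAt (fun x => y x * (-x) ^ b)
      ((-q) ^ (b - 1) * (-q * y' q - b * y q)) q := fun q hq =>
    hasDerivAt_mul_neg_rpow (hq.2.trans hf) (hy' q hq)
  have hmono : MonotoneOn (fun x => y x * (-x) ^ b) (Set.Icc a f) := by
    refine monotoneOn_of_deriv_nonneg (convex_Icc a f) (continuousOn_mul_neg_rpow hf hy) ?_ ?_
    · rw [interior_Icc]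
      exact fun q hq => (hderiv q hq).differentiableAt.differentiableWithinAt
    · rw [interior_Icc]
      intro q hq
      rw [(hderiv q hq).deriv]
      exact mul_nonneg (Real.rpow_nonneg (neg_pos.2 (hq.2.trans hf)).le _)
        (sub_nonneg.2 (hle q hq))
  have hval : y a * (-a) ^ b ≤ y f * (-f) ^ b :=
    hmono (Set.left_mem_Icc.2 haf) (Set.right_mem_Icc.2 haf) haf
  have hf' : y f * (-f) ^ b ≤ 0 :=
    mul_nonpos_of_nonpos_of_nonneg hyf (Real.rpow_nonneg (neg_pos.2 hf).le _)
  exact nonpos_of_mul_nonpos_left (hval.trans hf')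
    (Real.rpow_pos_of_pos (neg_pos.2 (haf.trans_lt hf)) _)

end WeightedGrowth

/-- Qualitative properties of the solution `w^⋆` of the dual face-lift ODE
`-w^⋆(q) + (1-δ) q (w^⋆)'(q) + F^⋆(δq) = 0` on `(-∞, f_δ)` with `w^⋆(f_δ) = 0`,
where `δ > 1`, `p₀ < 0`, `f_δ := p₀/δ`, and `F^⋆` is concave, differentiable,
nondecreasing, vanishes on `[p₀, ∞)` and is strictly concave on `(-∞, p₀]`:
then `w^⋆ ≤ F^⋆` on `(-∞, f_δ]`, `w^⋆` is strictly concave there, and `w^⋆` is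
strictly increasing on `(-∞, f_δ]`. -/
theorem dual_facelift_ODE_qualitative
    (δ p₀ : ℝ) (hδ : 1 < δ) (hp₀ : p₀ < 0)
    (Fs : ℝ → ℝ) (hFsconc : ConcaveOn ℝ Set.univ Fs) (hFsdiff : Differentiable ℝ Fs)
    (hFsmono : Monotone Fs) (hFszero : ∀ q, p₀ ≤ q → Fs q = 0)
    (hFsstrict : StrictConcaveOn ℝ (Set.Iic p₀) Fs)
    (ws ws' : ℝ → ℝ)
    (hwscont : ContinuousOn ws (Set.Iic (p₀ / δ)))
    (hws' : ∀ q, q < p₀ / δ → HasDerivAt ws (ws' q) q)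
    (hws'cont : ContinuousOn ws' (Set.Iio (p₀ / δ)))
    (hODE : ∀ q, q < p₀ / δ → -ws q + (1 - δ) * q * ws' q + Fs (δ * q) = 0)
    (hwsf : ws (p₀ / δ) = 0) :
    (∀ q, q ≤ p₀ / δ → ws q ≤ Fs q) ∧
    StrictConcaveOn ℝ (Set.Iic (p₀ / δ)) ws ∧
    StrictMonoOn ws (Set.Iic (p₀ / δ)) := by
  have hδ0 : 0 < δ := one_pos.trans hδ
  have hc : 0 < δ - 1 := sub_pos.2 hδ
  have hmulf : δ * (p₀ / δ) = p₀ := mul_div_cancel₀ p₀ hδ0.ne'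
  set f := p₀ / δ
  have hf : f < 0 := div_neg_of_neg_of_pos hp₀ hδ0
  have hp₀f : p₀ ≤ f := by nlinarith
  have hFanti : StrictAntiOn (deriv Fs) (Set.Iic p₀) :=
    hFsstrict.strictAntiOn_deriv fun x _ => hFsdiff x
  have hGanti : ∀ q r, q < r → r ≤ f → deriv Fs (δ * r) < deriv Fs (δ * q) := by
    intro q r hqr hr
    have hr' : δ * r ≤ p₀ := by rw [← hmulf]; exact mul_le_mul_of_nonneg_left hr hδ0.le
    have hlt : δ * q < δ * r := mul_lt_mul_of_pos_left hqr hδ0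
    exact hFanti (hlt.le.trans hr') hr' hlt
  have hGpos : ∀ q, q < f → 0 < deriv Fs (δ * q) := fun q hq =>
    (hFsmono.deriv_nonneg).trans_lt (hGanti q f hq le_rfl)
  -- `V` extends the derivative of `ws` continuously to the endpoint, with value `0` there.
  let V : ℝ → ℝ := fun q => (ws q - Fs (δ * q)) / ((1 - δ) * q)
  have hne : ∀ q, q ≤ f → (1 - δ) * q ≠ 0 := fun q hq =>
    mul_ne_zero (by linarith) (hq.trans_lt hf).ne
  have hVw : ∀ q, q < f → ws' q = V q := by
    intro q hq
    simp only [V]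
    rw [eq_div_iff (hne q hq.le)]
    linarith [hODE q hq]
  have hVf : V f = 0 := by
    simp [V, hwsf, hmulf, hFszero p₀ le_rfl]
  have hVcont : ContinuousOn V (Set.Iic f) :=
    (hwscont.sub (hFsdiff.continuous.comp (continuous_const_mul δ)).continuousOn).div
      (by fun_prop) hne
  have hV' : ∀ q, q < f →
      HasDerivAt V (δ / (δ - 1) * (V q - deriv Fs (δ * q)) / (-q)) q := by
    intro q hq
    have hFδ : HasDerivAt (fun x => Fs (δ * x)) (deriv Fs (δ * q) * (δ * 1)) q :=
      (hFsdiff (δ * q)).hasDerivAt.comp q ((hasDerivAt_id q).const_mul δ)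
    have hden : HasDerivAt (fun x => (1 - δ) * x) ((1 - δ) * 1) q :=
      (hasDerivAt_id q).const_mul (1 - δ)
    refine (((hws' q hq).sub hFδ).div hden (hne q hq.le)).congr_deriv ?_
    have hnum : ws q - Fs (δ * q) = V q * ((1 - δ) * q) := by
      simp only [V]
      rw [div_mul_cancel₀ _ (hne q hq.le)]
    have hq0 : q ≠ 0 := (hq.trans hf).ne
    have h1 : 1 - δ ≠ 0 := by linarith
    have h2 : δ - 1 ≠ 0 := hc.ne'
    simp only [Pi.sub_apply]
    rw [hnum, hVw q hq]
    have h3 : δ - 1 = -(1 - δ) := by ring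
    rw [h3]
    field_simp
    ring
  have hVode : ∀ q, q < f → -q * (δ / (δ - 1) * (V q - deriv Fs (δ * q)) / (-q)) =
      δ / (δ - 1) * (V q - deriv Fs (δ * q)) := fun q hq =>
    mul_div_cancel₀ _ (neg_pos.2 (hq.trans hf)).ne'
  have hβ : 0 < δ / (δ - 1) := div_pos hδ0 hc
  have hVpos : ∀ a, a < f → 0 < V a := by
    intro a ha
    refine neg_neg_iff_pos.1 (neg_of_mul_lt_neg_mul_deriv (y := fun q => -V q)
      (b := δ / (δ - 1)) hf ha (hVcont.mono Set.Icc_subset_Iic_self).neg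
      (fun q hq => (hV' q hq.2).neg) (fun q hq => ?_) (by simp [hVf]))
    rw [mul_neg, mul_neg (-q), hVode q hq.2]
    nlinarith [mul_pos hβ (hGpos q hq.2)]
  have hVlt : ∀ a, a < f → V a < deriv Fs (δ * a) := by
    intro a ha
    refine sub_neg.1 (neg_of_mul_lt_neg_mul_deriv (y := fun q => V q - deriv Fs (δ * a))
      (b := δ / (δ - 1)) hf ha
      ((hVcont.mono Set.Icc_subset_Iic_self).sub continuousOn_const)
      (fun q hq => (hV' q hq.2).sub_const _) (fun q hq => ?_) ?_)
    · rw [hVode q hq.2]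
      exact mul_lt_mul_of_pos_left (sub_lt_sub_left (hGanti a q hq.1 hq.2.le) _) hβ
    · simpa [hVf] using (hGpos a ha).le
  have hVanti : StrictAntiOn V (Set.Iic f) := by
    refine strictAntiOn_of_deriv_neg (convex_Iic f) hVcont ?_
    rw [interior_Iic]
    intro q hq
    rw [(hV' q hq).deriv]
    exact div_neg_of_neg_of_pos (mul_neg_of_pos_of_neg hβ (sub_neg.2 (hVlt q hq)))
      (neg_pos.2 (lt_trans hq hf))
  have hderiv : ∀ q, q < f → deriv ws q = V q := fun q hq =>
    (hws' q hq).deriv.trans (hVw q hq)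
  refine ⟨fun a ha => ?_, ?_, ?_⟩
  · refine sub_nonpos.1 (nonpos_of_mul_le_neg_mul_deriv (y := fun q => ws q - Fs q)
      (b := 1 / (δ - 1)) hf ha
      ((hwscont.mono Set.Icc_subset_Iic_self).sub hFsdiff.continuous.continuousOn)
      (fun q hq => (hws' q hq.2).sub (hFsdiff q).hasDerivAt) (fun q hq => ?_)
      (by simp [hwsf, hFszero f hp₀f]))
    have hq0 : q < 0 := hq.2.trans hf
    have hlt : δ * q < q := by nlinarith
    have htan := hFsconc.deriv_le_slope (Set.mem_univ _) (Set.mem_univ _) hlt (hFsdiff q)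
    rw [slope_def_field, le_div_iff₀ (sub_pos.2 hlt)] at htan
    rw [one_div_mul_eq_div, div_le_iff₀ hc]
    linarith [hODE q hq.2]
  · refine StrictAntiOn.strictConcaveOn_of_deriv (convex_Iic f) hwscont ?_
    rw [interior_Iic]
    intro q hq r hr hqr
    rw [hderiv q hq, hderiv r hr]
    exact hVanti (Set.Iio_subset_Iic_self hq) (Set.Iio_subset_Iic_self hr) hqr
  · refine strictMonoOn_of_deriv_pos (convex_Iic f) hwscont ?_
    rw [interior_Iic]
    intro q hq
    rw [hderiv q hq]
    exact hVpos q hq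
end

section
/- Let σ, ψ, η, h > 0 and 0 ≤ β < η/(ψ+η). For z ∈ ℝ let â(z) := max((z−β)/h, 0) (the maximizer over a ≥ 0 of za − (h a²/2 + βa)). Then sup over z ∈ ℝ of { â(z) − (σ²ψ/2)z² − ((h/2)â(z)² + βâ(z)) − (ησ²/2)z² + ησ²z } equals (1/(2h))·[ (σ²hη+1)²/(σ²h(ψ+η)+1) + β(β−2) ]. -/
open Real Set

/-- A concave quadratic is bounded by its value at the vertex. -/
lemma two_mul_sub_mul_sq_le_div {c : ℝ} (hc : 0 < c) (b z : ℝ) :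
    2 * b * z - c * z ^ 2 ≤ b ^ 2 / c := by
  rw [le_div_iff₀ hc]
  nlinarith [sq_nonneg (c * z - b)]

/-- In the Holmström–Milgrom model with early retirement and quadratic cost of effort
`h(a) = (h/2)a² + βa` on `[0,∞)`, with `â(z) = max((z-β)/h, 0)` the optimal effort,
the Hamiltonian of the principal's HJB equation evaluated along the retirement
obstacle equals the displayed closed form. -/
theorem HM_hamiltonian_on_obstacle
    (σ ψ η h β : ℝ) (hσ : 0 < σ) (hψ : 0 < ψ) (hη : 0 < η) (hh : 0 < h)
    (hβ0 : 0 ≤ β) (hβ : β < η / (ψ + η)) :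
    (⨆ z : ℝ,
      (max ((z - β) / h) 0 - σ ^ 2 * ψ / 2 * z ^ 2
        - (h / 2 * (max ((z - β) / h) 0) ^ 2 + β * max ((z - β) / h) 0)
        - η * σ ^ 2 / 2 * z ^ 2 + η * σ ^ 2 * z))
      = 1 / (2 * h) *
        ((σ ^ 2 * h * η + 1) ^ 2 / (σ ^ 2 * h * (ψ + η) + 1) + β * (β - 2)) := by
  have hs : 0 < ψ + η := by positivity
  have hβ' : β * (ψ + η) < η := (lt_div_iff₀ hs).mp hβ
  have hσh : 0 < σ ^ 2 * h := by positivity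
  have hc : 0 < σ ^ 2 * h * (ψ + η) + 1 := by positivity
  have value_of_le : ∀ z, β ≤ z →
      max ((z - β) / h) 0 - σ ^ 2 * ψ / 2 * z ^ 2
        - (h / 2 * (max ((z - β) / h) 0) ^ 2 + β * max ((z - β) / h) 0)
        - η * σ ^ 2 / 2 * z ^ 2 + η * σ ^ 2 * z
      = 1 / (2 * h) * ((2 * (σ ^ 2 * h * η + 1) * z
          - (σ ^ 2 * h * (ψ + η) + 1) * z ^ 2) + β * (β - 2)) := by
    intro z hz
    rw [max_eq_left (div_nonneg (sub_nonneg.mpr hz) hh.le)]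
    field_simp
    ring
  have value_le : ∀ z, β ≤ z →
      max ((z - β) / h) 0 - σ ^ 2 * ψ / 2 * z ^ 2
        - (h / 2 * (max ((z - β) / h) 0) ^ 2 + β * max ((z - β) / h) 0)
        - η * σ ^ 2 / 2 * z ^ 2 + η * σ ^ 2 * z
      ≤ 1 / (2 * h) *
        ((σ ^ 2 * h * η + 1) ^ 2 / (σ ^ 2 * h * (ψ + η) + 1) + β * (β - 2)) := by
    intro z hz
    rw [value_of_le z hz]
    gcongr
    exact two_mul_sub_mul_sq_le_div hc _ z
  refine IsGreatest.csSup_eq ⟨⟨(σ ^ 2 * h * η + 1) / (σ ^ 2 * h * (ψ + η) + 1), ?_⟩, ?_⟩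
  · have hβ1 : β ≤ 1 := hβ.le.trans ((div_le_one hs).mpr (by linarith))
    refine (value_of_le _ ?_).trans ?_
    · rw [le_div_iff₀ hc]
      nlinarith [mul_lt_mul_of_pos_left hβ' hσh]
    · field_simp
      ring
  · rintro _ ⟨z, rfl⟩
    rcases le_total β z with hz | hz
    · exact value_le z hz
    · refine le_trans ?_ (value_le β le_rfl)
      simp only [sub_self, zero_div, max_self,
        max_eq_right (div_nonpos_of_nonpos_of_nonneg (sub_nonpos.mpr hz) hh.le)]
      have hz' : z * (ψ + η) ≤ β * (ψ + η) := mul_le_mul_of_nonneg_right hz hs.le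
      have key : 0 ≤ σ ^ 2 * ((β - z) * (2 * η - (ψ + η) * (β + z))) :=
        mul_nonneg (sq_nonneg σ) (mul_nonneg (sub_nonneg.mpr hz) (by linarith))
      linarith
end

section
/- Let A ⊆ [0,∞) be a compact set with 0 ∈ A, let h : A → [0,∞) satisfy h(0) = 0, and let δ, η > 0 and β > 0 be such that h(a) ≥ βa for all a ∈ A. Then for every p ≤ −1/(βδ) and every q ≤ 0, one has 𝔍₀(p,q) = 0. -/
open Real Set

/-- The set of values `â + δ h(â) p + δ η z² q` where `z ∈ ℝ` and `â` maximizes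
`a ↦ z a - h(a)` over `A` (i.e. `â ∈ Â(z)`). -/
def J0set (A : Set ℝ) (h : ℝ → ℝ) (δ η p q : ℝ) : Set ℝ :=
  { v | ∃ z : ℝ, ∃ a ∈ A, (∀ b ∈ A, z * b - h b ≤ z * a - h a) ∧
      v = a + δ * h a * p + δ * η * z ^ 2 * q }

/-- The drift-adjustment operator `𝔍₀(p,q) = sup { â + δ h(â) p + δ η z² q }`. -/
noncomputable def J0 (A : Set ℝ) (h : ℝ → ℝ) (δ η p q : ℝ) : ℝ :=
  sSup (J0set A h δ η p q)

/-- If `h(a) ≥ β a` on `A` with `β > 0`, then for every `p ≤ -1/(βδ)` and `q ≤ 0`,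
the drift-adjustment operator vanishes: `𝔍₀(p,q) = 0`. -/
theorem J0_eq_zero_of_large_neg_slope
    (A : Set ℝ) (hA : IsCompact A) (hA0 : (0:ℝ) ∈ A) (hAsub : A ⊆ Set.Ici 0)
    (h : ℝ → ℝ) (hhpos : ∀ a ∈ A, 0 ≤ h a) (hh0 : h 0 = 0)
    (δ η β : ℝ) (hδ : 0 < δ) (hη : 0 < η) (hβ : 0 < β)
    (hhβ : ∀ a ∈ A, β * a ≤ h a)
    (p q : ℝ) (hp : p ≤ -1 / (β * δ)) (hq : q ≤ 0) :
    J0 A h δ η p q = 0 := by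
  have hg : IsGreatest (J0set A h δ η p q) 0 := by
    refine ⟨⟨0, 0, hA0, fun b hb => ?_, by simp [hh0]⟩, ?_⟩
    · simpa [hh0] using hhpos b hb
    · rintro v ⟨z, a, ha, -, rfl⟩
      have hβδ : 0 < β * δ := mul_pos hβ hδ
      have hp' : p * (β * δ) ≤ -1 := (le_div_iff₀ hβδ).mp hp
      have hp0 : p ≤ 0 := hp.trans (div_nonpos_of_nonpos_of_nonneg (by norm_num) hβδ.le)
      have hdrift : δ * h a * p ≤ δ * (β * a) * p :=
        mul_le_mul_of_nonpos_right (mul_le_mul_of_nonneg_left (hhβ a ha) hδ.le) hp0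
      have hslope : a * (p * (β * δ)) ≤ a * (-1) :=
        mul_le_mul_of_nonneg_left hp' (hAsub ha)
      have hquad : δ * η * z ^ 2 * q ≤ 0 :=
        mul_nonpos_of_nonneg_of_nonpos (by positivity) hq
      linarith
  exact hg.csSup_eq
end

section
/- Let ā > 0, let h : [0,ā] → [0,∞) be three times continuously differentiable with h(0) = 0, set β := h′(0), and let δ, η > 0. Let p ≤ 0 and q ≤ 0 be such that (i) p·h″(a) + η·q·((h′)²)″(a) ≤ 0 for all a ∈ [0,ā], and (ii) 1 + δβp + 2δηβ·q·h″(0) ≤ 0. Then the map ψ(a) := a + δp·h(a) + δηq·(h′(a))² attains its maximum over [0,ā] at a = 0, and sup_{a∈[0,ā]} ψ(a) = δηq·β² ≤ 0. -/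
open Real Set

/-- A function with nonpositive one-sided derivative on a compact interval is antitone there. -/
theorem antitoneOn_Icc_of_hasDerivWithinAt_nonpos {f f' : ℝ → ℝ} {a b : ℝ}
    (hf : ∀ x ∈ Set.Icc a b, HasDerivWithinAt f (f' x) (Set.Icc a b) x)
    (hf' : ∀ x ∈ Set.Icc a b, f' x ≤ 0) : AntitoneOn f (Set.Icc a b) :=
  antitoneOn_of_hasDerivWithinAt_nonpos (convex_Icc a b)
    (fun x hx => (hf x hx).continuousWithinAt)
    (fun x hx => (hf x (interior_subset hx)).mono interior_subset)
    (fun x hx => hf' x (interior_subset hx))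

/-- Condition (NGP3), pointwise form: if the agent's cost of effort `h` is `C³` on
`[0, ā]`, nonnegative with `h(0) = 0` and `β := h'(0)`, and if `p ≤ 0`, `q ≤ 0`
satisfy (i) `p h''(a) + η q ((h')²)''(a) ≤ 0` on `[0, ā]` (note
`((h')²)''(a) = 2(h''(a)² + h'(a)h'''(a))`) and (ii) `1 + δβp + 2δηβ q h''(0) ≤ 0`,
then `ψ(a) = a + δp h(a) + δηq (h'(a))²` attains its maximum over `[0, ā]` at
`a = 0`, and `sup ψ = δηq β² ≤ 0`. -/
theorem ngp3_max_at_zero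
    (abar : ℝ) (habar : 0 < abar)
    (h h' h'' h''' : ℝ → ℝ)
    (hd1 : ∀ a ∈ Set.Icc (0:ℝ) abar, HasDerivWithinAt h (h' a) (Set.Icc 0 abar) a)
    (hd2 : ∀ a ∈ Set.Icc (0:ℝ) abar, HasDerivWithinAt h' (h'' a) (Set.Icc 0 abar) a)
    (hd3 : ∀ a ∈ Set.Icc (0:ℝ) abar, HasDerivWithinAt h'' (h''' a) (Set.Icc 0 abar) a)
    (hd3c : ContinuousOn h''' (Set.Icc 0 abar))
    (hpos : ∀ a ∈ Set.Icc (0:ℝ) abar, 0 ≤ h a) (h0 : h 0 = 0)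
    (δ η : ℝ) (hδ : 0 < δ) (hη : 0 < η)
    (p q : ℝ) (hp : p ≤ 0) (hq : q ≤ 0)
    (hconc : ∀ a ∈ Set.Icc (0:ℝ) abar,
      p * h'' a + η * q * (2 * ((h'' a) ^ 2 + h' a * h''' a)) ≤ 0)
    (hslope : 1 + δ * (h' 0) * p + 2 * δ * η * (h' 0) * q * h'' 0 ≤ 0) :
    (∀ a ∈ Set.Icc (0:ℝ) abar,
      a + δ * p * h a + δ * η * q * (h' a) ^ 2
        ≤ 0 + δ * p * h 0 + δ * η * q * (h' 0) ^ 2) ∧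
    sSup { v | ∃ a ∈ Set.Icc (0:ℝ) abar, v = a + δ * p * h a + δ * η * q * (h' a) ^ 2 }
      = δ * η * q * (h' 0) ^ 2 ∧
    δ * η * q * (h' 0) ^ 2 ≤ 0 := by
  have h_zero : (0 : ℝ) ∈ Set.Icc 0 abar := ⟨le_rfl, habar.le⟩
  have h_psi : ∀ a ∈ Set.Icc (0 : ℝ) abar,
      HasDerivWithinAt (fun a => a + δ * p * h a + δ * η * q * (h' a) ^ 2)
        (1 + δ * p * h' a + δ * η * q * (2 * h' a * h'' a)) (Set.Icc 0 abar) a := by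
    intro a ha
    refine (((hasDerivWithinAt_id a _).add ((hd1 a ha).const_mul (δ * p))).add
      (((hd2 a ha).pow 2).const_mul (δ * η * q))).congr_deriv ?_
    norm_num
  have h_psi' : ∀ a ∈ Set.Icc (0 : ℝ) abar,
      HasDerivWithinAt (fun a => 1 + δ * p * h' a + δ * η * q * (2 * h' a * h'' a))
        (δ * (p * h'' a + η * q * (2 * ((h'' a) ^ 2 + h' a * h''' a)))) (Set.Icc 0 abar) a := by
    intro a ha
    refine ((((hd2 a ha).const_mul (δ * p)).const_add 1).add
      ((((hd2 a ha).const_mul 2).mul (hd3 a ha)).const_mul (δ * η * q))).congr_deriv ?_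
    ring
  have h_anti' := antitoneOn_Icc_of_hasDerivWithinAt_nonpos h_psi'
    (fun a ha => mul_nonpos_of_nonneg_of_nonpos hδ.le (hconc a ha))
  have h_anti := antitoneOn_Icc_of_hasDerivWithinAt_nonpos h_psi fun a ha => by
    have := h_anti' h_zero ha ha.1
    dsimp only at this
    linarith
  have h_max : ∀ a ∈ Set.Icc (0 : ℝ) abar,
      a + δ * p * h a + δ * η * q * (h' a) ^ 2
        ≤ 0 + δ * p * h 0 + δ * η * q * (h' 0) ^ 2 :=
    fun a ha => h_anti h_zero ha ha.1
  refine ⟨h_max, IsGreatest.csSup_eq ⟨⟨0, h_zero, by simp [h0]⟩, ?_⟩, ?_⟩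
  · rintro v ⟨a, ha, rfl⟩
    simpa [h0] using h_max a ha
  · exact mul_nonpos_of_nonpos_of_nonneg
      (mul_nonpos_of_nonneg_of_nonpos (mul_pos hδ hη).le hq) (sq_nonneg _)
end

section
/- Let A ⊆ [0,∞) be compact with 0 ∈ A, h : A → [0,∞) with h(0) = 0, and δ, η > 0. Let F^⋆ : ℝ → ℝ satisfy F^⋆(q) ≤ 0 for all q and F^⋆(q) < 0 for all q < 0. Let v : [0,∞) → ℝ be twice differentiable at 0 with v(0) = 0 and suppose the dynamic programming equation holds at y = 0, i.e. v(0) − δ·0·v′(0) + F^⋆(δv′(0)) − max(𝔍₀(v′(0), v″(0)), 0) = 0, with 𝔍₀(v′(0), v″(0)) finite. Then v′(0) ≥ 0, F^⋆(δv′(0)) = 0, and 𝔍₀(v′(0), v″(0)) = 0. -/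
open Real Set

/-- At `z = 0` the action `0` is optimal, and it contributes the value `0`. -/
theorem zero_mem_J0set {A : Set ℝ} {h : ℝ → ℝ} (hA0 : (0:ℝ) ∈ A)
    (hhpos : ∀ a ∈ A, 0 ≤ h a) (hh0 : h 0 = 0) (δ η p q : ℝ) :
    (0:ℝ) ∈ J0set A h δ η p q :=
  ⟨0, 0, hA0, fun b hb => by simpa [hh0] using hhpos b hb, by simp [hh0]⟩

/-- Behaviour of a solution of the dynamic programming equation at the boundary
`y = 0`: if `v(0) = 0`, `v` is twice differentiable at `0` (with first derivative
function `vd` near `0` in `[0,∞)` and second derivative `v2` at `0`), the equation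
`v(0) - δ·0·v'(0) + F^⋆(δ v'(0)) - max(𝔍₀(v'(0), v''(0)), 0) = 0` holds with
`𝔍₀(v'(0), v''(0))` finite, and `F^⋆ ≤ 0` with `F^⋆ < 0` on `(-∞,0)`, then
`v'(0) ≥ 0`, `F^⋆(δ v'(0)) = 0` and `𝔍₀(v'(0), v''(0)) = 0`. -/
theorem DPE_boundary_behaviour
    (A : Set ℝ) (hA : IsCompact A) (hA0 : (0:ℝ) ∈ A) (hAsub : A ⊆ Set.Ici 0)
    (h : ℝ → ℝ) (hhpos : ∀ a ∈ A, 0 ≤ h a) (hh0 : h 0 = 0)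
    (δ η : ℝ) (hδ : 0 < δ) (hη : 0 < η)
    (Fs : ℝ → ℝ) (hFsnonpos : ∀ q, Fs q ≤ 0) (hFsneg : ∀ q, q < 0 → Fs q < 0)
    (v vd : ℝ → ℝ) (v2 : ℝ)
    (hv0 : v 0 = 0)
    (hvd : ∀ᶠ y in nhdsWithin 0 (Set.Ici 0), HasDerivWithinAt v (vd y) (Set.Ici 0) y)
    (hvd0 : HasDerivWithinAt v (vd 0) (Set.Ici 0) 0)
    (hv2 : HasDerivWithinAt vd v2 (Set.Ici 0) 0)
    (hfin1 : (J0set A h δ η (vd 0) v2).Nonempty)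
    (hfin2 : BddAbove (J0set A h δ η (vd 0) v2))
    (hDPE : v 0 - δ * 0 * vd 0 + Fs (δ * vd 0) - max (J0 A h δ η (vd 0) v2) 0 = 0) :
    0 ≤ vd 0 ∧ Fs (δ * vd 0) = 0 ∧ J0 A h δ η (vd 0) v2 = 0 := by
  have hJ : 0 ≤ J0 A h δ η (vd 0) v2 :=
    le_csSup hfin2 (zero_mem_J0set hA0 hhpos hh0 δ η (vd 0) v2)
  rw [max_eq_left hJ, hv0] at hDPE
  have hF := hFsnonpos (δ * vd 0)
  have hF0 : Fs (δ * vd 0) = 0 := by linarith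
  refine ⟨?_, hF0, by linarith⟩
  by_contra! hneg
  exact (hFsneg _ (mul_neg_of_pos_of_neg hδ hneg)).ne hF0
end

section
/- Let A ⊆ [0,∞) be compact with 0 ∈ A and ā := max A > 0, let h : A → [0,∞) be continuous with h(0) = 0, let δ, η > 0 with δ ≠ 1, and let F^⋆ : ℝ → ℝ satisfy F^⋆(0) = 0. Suppose v is affine on a nondegenerate interval (y₀,y₁) ⊆ [0,∞), say v(y) = b₀ + b·y there, and v is twice differentiable and satisfies the dynamic programming equation v(y) − δy v′(y) + F^⋆(δv′(y)) − max(𝔍₀(v′(y), v″(y)), 0) = 0 for all y ∈ (y₀,y₁). Then b = 0 and b₀ = ā. -/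
open Real Set

/-- With `p = q = 0` the supremum `𝔍₀` is the largest action: the maximizers of
`a ↦ z a - h(a)` approach `max A` as `z → ∞`. -/
theorem isLUB_J0set_zero_zero {A : Set ℝ} (hA : IsCompact A) {abar : ℝ}
    (habar : IsGreatest A abar) {h : ℝ → ℝ} (hhcont : ContinuousOn h A)
    (hhpos : ∀ a ∈ A, 0 ≤ h a) (δ η : ℝ) : IsLUB (J0set A h δ η 0 0) abar := by
  constructor
  · rintro _ ⟨z, a, ha, -, rfl⟩
    simpa using habar.2 ha
  · intro u hu
    refine le_of_forall_pos_le_add fun ε hε => ?_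
    obtain ⟨a, ha, hmax⟩ := hA.exists_isMaxOn ⟨abar, habar.1⟩
      ((continuousOn_const.mul continuousOn_id).sub hhcont :
        ContinuousOn (fun a => (h abar + 1) / ε * a - h a) A)
    have hau : a ≤ u := hu ⟨(h abar + 1) / ε, a, ha, fun b hb => hmax hb, by ring⟩
    have hle : (h abar + 1) / ε * abar - h abar ≤ (h abar + 1) / ε * a - h a := hmax habar.1
    have hbar := hhpos abar habar.1
    have hz : 0 < (h abar + 1) / ε := by positivity
    have hzε : (h abar + 1) / ε * ε = h abar + 1 := div_mul_cancel₀ _ hε.ne'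
    have : (h abar + 1) / ε * abar ≤ (h abar + 1) / ε * (a + ε) := by
      rw [mul_add, hzε]
      linarith [hhpos a ha]
    linarith [le_of_mul_le_mul_left this hz]

theorem J0_zero_zero {A : Set ℝ} (hA : IsCompact A) {abar : ℝ}
    (habar : IsGreatest A abar) {h : ℝ → ℝ} (hhcont : ContinuousOn h A)
    (hhpos : ∀ a ∈ A, 0 ≤ h a) (δ η : ℝ) : J0 A h δ η 0 0 = abar :=
  have hlub := isLUB_J0set_zero_zero hA habar hhcont hhpos δ η
  hlub.csSup_eq (by
    by_contra hne
    rw [Set.not_nonempty_iff_eq_empty.1 hne] at hlub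
    linarith [hlub.2 (show abar - 1 ∈ upperBounds ∅ by simp)])

/-- If `δ ≠ 1` and `v` is affine, `v(y) = b₀ + b y`, on a nondegenerate interval
`(y₀, y₁) ⊆ [0,∞)` where it satisfies the dynamic programming equation
`v - δ y v' + F^⋆(δ v') - 𝔍₀(v', v'')⁺ = 0`, then `b = 0` and `b₀ = ā := max A`. -/
theorem affine_piece_forces_constants
    (A : Set ℝ) (hA : IsCompact A) (hA0 : (0:ℝ) ∈ A) (hAsub : A ⊆ Set.Ici 0)
    (abar : ℝ) (habar : IsGreatest A abar) (habarpos : 0 < abar)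
    (h : ℝ → ℝ) (hhcont : ContinuousOn h A) (hh0 : h 0 = 0) (hhpos : ∀ a ∈ A, 0 ≤ h a)
    (δ η : ℝ) (hδ : 0 < δ) (hη : 0 < η) (hδ1 : δ ≠ 1)
    (Fs : ℝ → ℝ) (hFs0 : Fs 0 = 0)
    (v : ℝ → ℝ) (b₀ b y₀ y₁ : ℝ) (hy : y₀ < y₁) (hy₀ : 0 ≤ y₀)
    (hAff : ∀ y ∈ Set.Ioo y₀ y₁, v y = b₀ + b * y)
    (hDPE : ∀ y ∈ Set.Ioo y₀ y₁,
      v y - δ * y * deriv v y + Fs (δ * deriv v y)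
        - max (J0 A h δ η (deriv v y) (deriv (deriv v) y)) 0 = 0) :
    b = 0 ∧ b₀ = abar := by
  have hd : ∀ y ∈ Set.Ioo y₀ y₁, deriv v y = b := fun y hyI => by
    have hev : v =ᶠ[nhds y] fun y => b₀ + b * y :=
      Filter.eventually_of_mem (isOpen_Ioo.mem_nhds hyI) hAff
    rw [hev.deriv_eq]
    simp
  have hdd : ∀ y ∈ Set.Ioo y₀ y₁, deriv (deriv v) y = 0 := fun y hyI => by
    have hev : deriv v =ᶠ[nhds y] fun _ => b :=
      Filter.eventually_of_mem (isOpen_Ioo.mem_nhds hyI) hd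
    rw [hev.deriv_eq, deriv_const]
  have key : ∀ y ∈ Set.Ioo y₀ y₁,
      b₀ + b * y - δ * y * b + Fs (δ * b) - max (J0 A h δ η b 0) 0 = 0 := fun y hyI => by
    have := hDPE y hyI
    rwa [hdd y hyI, hd y hyI, hAff y hyI] at this
  obtain ⟨s, hs₀, hs₁⟩ := exists_between hy
  obtain ⟨t, hst, ht₁⟩ := exists_between hs₁
  have hks := key s ⟨hs₀, hs₁⟩
  have hkt := key t ⟨hs₀.trans hst, ht₁⟩
  have hb : b = 0 := by
    have hprod : b * ((1 - δ) * (t - s)) = 0 := by linear_combination hkt - hks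
    exact (mul_eq_zero.1 hprod).resolve_right
      (mul_ne_zero (sub_ne_zero.2 hδ1.symm) (sub_ne_zero.2 hst.ne'))
  subst hb
  rw [J0_zero_zero hA habar hhcont hhpos, max_eq_left habarpos.le, mul_zero δ, hFs0] at hks
  exact ⟨rfl, by linarith⟩
end

section
/- Let r, ρ > 0, δ := r/ρ, and λ ≥ 0. Let F^⋆ : ℝ → ℝ be concave and differentiable, and let G^⋆ : ℝ → ℝ satisfy G^⋆(q) ≥ 0 for all q. Then the function f(T) := −e^{−ρT}·F^⋆(−λe^{(ρ−r)T}) + ∫₀^T ρe^{−ρt}·(G^⋆ − F^⋆)(−δλe^{(ρ−r)t}) dt is nondecreasing on [0,∞). -/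
open MeasureTheory Real Set

/-- A concave function lies below its tangent line at a point of differentiability. -/
theorem ConcaveOn.le_add_deriv_mul_sub {S : Set ℝ} {f : ℝ → ℝ} {x y : ℝ}
    (hf : ConcaveOn ℝ S f) (hx : x ∈ S) (hy : y ∈ S) (hd : DifferentiableAt ℝ f x) :
    f y ≤ f x + deriv f x * (y - x) := by
  rcases lt_trichotomy x y with h | rfl | h
  · have := hf.slope_le_deriv hx hy h hd
    rw [slope_def_field, div_le_iff₀ (sub_pos.2 h)] at this
    linarith
  · simp
  · have := hf.deriv_le_slope hy hx h hd
    rw [slope_def_field, le_div_iff₀ (sub_pos.2 h)] at this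
    linarith

/-- The time derivative of the discounted payment cost `-e^{-ρt} F(c e^{(ρ-r)t})`. -/
theorem hasDerivAt_neg_exp_mul_comp_exp {F : ℝ → ℝ} (hF : Differentiable ℝ F) (r ρ c t : ℝ) :
    HasDerivAt (fun t => -exp (-(ρ * t)) * F (c * exp ((ρ - r) * t)))
      (exp (-(ρ * t)) * (ρ * F (c * exp ((ρ - r) * t))
        + deriv F (c * exp ((ρ - r) * t)) * ((r - ρ) * (c * exp ((ρ - r) * t))))) t := by
  have hdisc : HasDerivAt (fun t => -exp (-(ρ * t))) (-(exp (-(ρ * t)) * -(ρ * 1))) t :=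
    ((hasDerivAt_id t).const_mul ρ).fun_neg.exp.fun_neg
  have harg : HasDerivAt (fun t => c * exp ((ρ - r) * t))
      (c * (exp ((ρ - r) * t) * ((ρ - r) * 1))) t :=
    ((hasDerivAt_id t).const_mul (ρ - r)).exp.const_mul c
  have hcomp : HasDerivAt (fun t => F (c * exp ((ρ - r) * t))) _ t :=
    (hF (c * exp ((ρ - r) * t))).hasDerivAt.comp t harg
  exact (hdisc.fun_mul hcomp).congr_deriv (by ring)

/-- In the first-best problem, with `δ := r/ρ`, `F^⋆` concave and differentiable,
`G^⋆ ≥ 0`, and `λ ≥ 0`, the principal's Lagrangian payoff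
`f(T) = -e^{-ρT} F^⋆(-λ e^{(ρ-r)T}) + ∫₀^T ρ e^{-ρt} (G^⋆-F^⋆)(-δλ e^{(ρ-r)t}) dt`
is nondecreasing on `[0,∞)` (the integrand being interval integrable). -/
theorem firstbest_payoff_monotone
    (r ρ lam : ℝ) (hr : 0 < r) (hρ : 0 < ρ) (hlam : 0 ≤ lam)
    (Fs Gs : ℝ → ℝ)
    (hFsconc : ConcaveOn ℝ Set.univ Fs) (hFsdiff : Differentiable ℝ Fs)
    (hGs : ∀ q, 0 ≤ Gs q)
    (hint : ∀ T : ℝ, IntervalIntegrable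
      (fun t => ρ * Real.exp (-(ρ * t)) *
        (Gs (-(r / ρ) * lam * Real.exp ((ρ - r) * t))
          - Fs (-(r / ρ) * lam * Real.exp ((ρ - r) * t))))
      MeasureTheory.volume 0 T) :
    MonotoneOn (fun T =>
      -Real.exp (-(ρ * T)) * Fs (-lam * Real.exp ((ρ - r) * T))
        + ∫ t in (0:ℝ)..T, ρ * Real.exp (-(ρ * t)) *
            (Gs (-(r / ρ) * lam * Real.exp ((ρ - r) * t))
              - Fs (-(r / ρ) * lam * Real.exp ((ρ - r) * t))))
      (Set.Ici 0) := by
  intro a _ b _ hab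
  have hderiv := hasDerivAt_neg_exp_mul_comp_exp hFsdiff r ρ (-lam)
  have hint_ab := (hint a).symm.trans (hint b)
  have key := intervalIntegral.integral_le_sub_of_hasDeriv_right_of_le hab
    (fun t _ => (hderiv t).continuousAt.continuousWithinAt)
    (fun t _ => (hderiv t).hasDerivWithinAt)
    ((intervalIntegrable_iff_integrableOn_Icc_of_le hab).1 hint_ab.neg) (fun t _ => by
      have htan := hFsconc.le_add_deriv_mul_sub (mem_univ (-lam * exp ((ρ - r) * t)))
        (mem_univ (-(r / ρ) * lam * exp ((ρ - r) * t))) (hFsdiff _)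
      have hG := hGs (-(r / ρ) * lam * exp ((ρ - r) * t))
      have hscale : ρ * (-(r / ρ) * lam * exp ((ρ - r) * t) - -lam * exp ((ρ - r) * t))
          = (r - ρ) * (-lam * exp ((ρ - r) * t)) := by
        field_simp
        ring
      rw [← hscale, Pi.neg_apply, mul_comm ρ (exp _), mul_assoc, ← mul_neg]
      refine mul_le_mul_of_nonneg_left ?_ (exp_pos _).le
      rw [mul_left_comm, ← mul_add, ← mul_neg]
      exact mul_le_mul_of_nonneg_left (by linarith) hρ.le)
  have hsplit := intervalIntegral.integral_add_adjacent_intervals (hint a) hint_ab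
  simp only [Pi.neg_apply, intervalIntegral.integral_neg] at key
  dsimp only
  linarith
end

section
/- Let γ > 1, γ′ := γ/(γ−1), and r, ρ > 0 with ρ < γr; set δ := r/ρ. Let A ⊆ [0,∞) be compact with 0 ∈ A and ā := max A, let h : A → [0,∞) be continuous with h(0) = 0, and define G^⋆(q) := sup_{a∈A}{a + q·h(a)}. Let F^⋆ : (−∞,0] → ℝ be continuous, strictly concave, with F^⋆(0) = 0 and −c₀(1+|q|^{γ′}) ≤ F^⋆(q) ≤ c₁(1−|q|^{γ′}) for all q ≤ 0, for some c₀, c₁ > 0. Then φ(λ) := ∫₀^∞ ρe^{−ρt}·(G^⋆ − F^⋆)(−δλe^{(ρ−r)t}) dt is finite for every λ ≥ 0, φ is strictly convex on [0,∞), φ(0) = ā, and φ(λ) → ∞ as λ → ∞. -/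
open MeasureTheory Real Set Filter

/-- The effort conjugate `G^⋆(q) = sup_{a ∈ A} {a + q h(a)}`. -/
noncomputable def Gstar (A : Set ℝ) (h : ℝ → ℝ) (q : ℝ) : ℝ :=
  sSup { w | ∃ a ∈ A, w = a + q * h a }

/-- The dual value of the first-best problem,
`φ(λ) = ∫₀^∞ ρ e^{-ρt} (G^⋆ - F^⋆)(-δ λ e^{(ρ-r)t}) dt` with `δ := r/ρ`. -/
noncomputable def phiFB (r ρ : ℝ) (A : Set ℝ) (h : ℝ → ℝ) (Fs : ℝ → ℝ) (lam : ℝ) : ℝ :=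
  ∫ t in Set.Ioi (0:ℝ), ρ * Real.exp (-(ρ * t)) *
    (Gstar A h (-(r / ρ) * lam * Real.exp ((ρ - r) * t))
      - Fs (-(r / ρ) * lam * Real.exp ((ρ - r) * t)))

/-- The values `a + q h(a)` form a set bounded above by their maximum over the compact set `A`. -/
lemma bddAbove_effort_values {A : Set ℝ} (hA : IsCompact A) {h : ℝ → ℝ} (hh : ContinuousOn h A)
    (q : ℝ) : BddAbove { w | ∃ a ∈ A, w = a + q * h a } := by
  have := (hA.image_of_continuousOn
    (continuousOn_id.add (continuousOn_const (c := q) |>.mul hh))).bddAbove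
  refine this.mono ?_
  rintro w ⟨a, ha, rfl⟩
  exact ⟨a, ha, rfl⟩

lemma le_Gstar {A : Set ℝ} (hA : IsCompact A) {h : ℝ → ℝ} (hh : ContinuousOn h A)
    {a : ℝ} (ha : a ∈ A) (q : ℝ) : a + q * h a ≤ Gstar A h q :=
  le_csSup (bddAbove_effort_values hA hh q) ⟨a, ha, rfl⟩

lemma Gstar_le {A : Set ℝ} (hA : A.Nonempty) {h : ℝ → ℝ} {q M : ℝ}
    (H : ∀ a ∈ A, a + q * h a ≤ M) : Gstar A h q ≤ M := by
  refine csSup_le ?_ ?_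
  · obtain ⟨a, ha⟩ := hA
    exact ⟨_, a, ha, rfl⟩
  · rintro w ⟨a, ha, rfl⟩
    exact H a ha

lemma monotone_Gstar {A : Set ℝ} (hA : IsCompact A) (hne : A.Nonempty) {h : ℝ → ℝ}
    (hh : ContinuousOn h A) (hpos : ∀ a ∈ A, 0 ≤ h a) : Monotone (Gstar A h) := by
  intro x y hxy
  refine Gstar_le hne fun a ha => le_trans ?_ (le_Gstar hA hh ha y)
  have := mul_le_mul_of_nonneg_right hxy (hpos a ha)
  linarith

lemma convexOn_Gstar {A : Set ℝ} (hA : IsCompact A) (hne : A.Nonempty) {h : ℝ → ℝ}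
    (hh : ContinuousOn h A) : ConvexOn ℝ univ (Gstar A h) := by
  refine ⟨convex_univ, fun x _ y _ a b ha hb hab => Gstar_le hne fun c hc => ?_⟩
  have h1 := mul_le_mul_of_nonneg_left (le_Gstar hA hh hc x) ha
  have h2 := mul_le_mul_of_nonneg_left (le_Gstar hA hh hc y) hb
  simp only [smul_eq_mul]
  calc c + (a * x + b * y) * h c = (a + b) * c + (a * x + b * y) * h c := by rw [hab, one_mul]
    _ ≤ _ := by linarith

/-- The discounted `p`-th power of the multiplier path is a pure exponential in time. -/
lemma discounted_rpow_eq {r ρ lam : ℝ} (hr : 0 < r) (hρ : 0 < ρ) (hlam : 0 ≤ lam) (p t : ℝ) :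
    exp (-(ρ * t)) * |(-(r / ρ) * lam * exp ((ρ - r) * t))| ^ p
      = (r / ρ * lam) ^ p * exp (-(ρ - (ρ - r) * p) * t) := by
  have h0 : 0 ≤ r / ρ * lam := by positivity
  have h1 : |(-(r / ρ) * lam * exp ((ρ - r) * t))| = r / ρ * lam * exp ((ρ - r) * t) := by
    rw [neg_mul, neg_mul, abs_neg, abs_of_nonneg (by positivity)]
  rw [h1, mul_rpow h0 (exp_pos _).le, ← exp_mul, mul_left_comm, ← exp_add]
  ring_nf

/-- The integral of a strictly convex function along linear rays, with a positive weight, is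
strictly convex. -/
lemma strictConvexOn_integral_weight {H w e : ℝ → ℝ}
    (hH : StrictConvexOn ℝ (Iic 0) H) (hw : ∀ t, 0 < w t) (he : ∀ t, e t < 0)
    (hint : ∀ x, 0 ≤ x → IntegrableOn (fun t => w t * H (x * e t)) (Ioi 0)) :
    StrictConvexOn ℝ (Ici 0) (fun x => ∫ t in Ioi (0 : ℝ), w t * H (x * e t)) := by
  refine ⟨convex_Ici 0, fun x hx y hy hxy a b ha hb hab => ?_⟩
  simp only [mem_Ici, smul_eq_mul] at *
  have hz : 0 ≤ a * x + b * y := by positivity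
  have key : ∀ t, 0 < a * (w t * H (x * e t)) + b * (w t * H (y * e t))
      - w t * H ((a * x + b * y) * e t) := by
    intro t
    have h1 := hH.2 (x := x * e t) (mul_nonpos_of_nonneg_of_nonpos hx (he t).le)
      (y := y * e t) (mul_nonpos_of_nonneg_of_nonpos hy (he t).le)
      (fun hc => hxy (mul_right_cancel₀ (he t).ne hc)) ha hb hab
    simp only [smul_eq_mul] at h1
    rw [show a * (x * e t) + b * (y * e t) = (a * x + b * y) * e t by ring] at h1
    have h2 := mul_lt_mul_of_pos_left h1 (hw t)
    linarith
  have hi : IntegrableOn (fun t => a * (w t * H (x * e t)) + b * (w t * H (y * e t))) (Ioi 0) :=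
    ((hint x hx).const_mul a).add ((hint y hy).const_mul b)
  have hpos : 0 < ∫ t in Ioi (0 : ℝ), (a * (w t * H (x * e t)) + b * (w t * H (y * e t))
      - w t * H ((a * x + b * y) * e t)) := by
    rw [integral_pos_iff_support_of_nonneg (fun t => (key t).le) (hi.sub (hint _ hz))]
    rw [Function.support_eq_univ fun t => (key t).ne']
    simp
  rw [integral_sub hi (hint _ hz), integral_add ((hint x hx).const_mul a)
    ((hint y hy).const_mul b), integral_const_mul, integral_const_mul] at hpos
  linarith

/-- When `ρ < γ r` (i.e. `δγ > 1`), the dual value `φ` of the first-best problem is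
finite for every `λ ≥ 0`, strictly convex on `[0,∞)`, satisfies `φ(0) = ā := max A`,
and tends to `∞` as `λ → ∞`. -/
theorem firstbest_dual_value_properties
    (γ r ρ : ℝ) (hγ : 1 < γ) (hr : 0 < r) (hρ : 0 < ρ) (hργ : ρ < γ * r)
    (A : Set ℝ) (hA : IsCompact A) (hA0 : (0:ℝ) ∈ A) (hAsub : A ⊆ Set.Ici 0)
    (abar : ℝ) (habar : IsGreatest A abar)
    (h : ℝ → ℝ) (hhcont : ContinuousOn h A) (hh0 : h 0 = 0) (hhpos : ∀ a ∈ A, 0 ≤ h a)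
    (Fs : ℝ → ℝ) (hFscont : ContinuousOn Fs (Set.Iic 0))
    (hFsconc : StrictConcaveOn ℝ (Set.Iic 0) Fs) (hFs0 : Fs 0 = 0)
    (c₀ c₁ : ℝ) (hc₀ : 0 < c₀) (hc₁ : 0 < c₁)
    (hFslb : ∀ q, q ≤ 0 → -c₀ * (1 + |q| ^ (γ / (γ - 1))) ≤ Fs q)
    (hFsub : ∀ q, q ≤ 0 → Fs q ≤ c₁ * (1 - |q| ^ (γ / (γ - 1)))) :
    (∀ lam, 0 ≤ lam → MeasureTheory.IntegrableOn
      (fun t => ρ * Real.exp (-(ρ * t)) *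
        (Gstar A h (-(r / ρ) * lam * Real.exp ((ρ - r) * t))
          - Fs (-(r / ρ) * lam * Real.exp ((ρ - r) * t)))) (Set.Ioi 0)) ∧
    StrictConvexOn ℝ (Set.Ici 0) (phiFB r ρ A h Fs) ∧
    phiFB r ρ A h Fs 0 = abar ∧
    Tendsto (phiFB r ρ A h Fs) atTop atTop := by
  have hne : A.Nonempty := ⟨0, hA0⟩
  set p := γ / (γ - 1) with hp
  have hp0 : 0 < p := div_pos (by linarith) (by linarith)
  have hκ : 0 < ρ - (ρ - r) * p := by
    have h1 : ρ - (ρ - r) * p = (γ * r - ρ) / (γ - 1) := by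
      rw [hp]
      field_simp [show γ - 1 ≠ 0 by linarith]
      ring
    rw [h1]
    exact div_pos (by linarith) (by linarith)
  set κ := ρ - (ρ - r) * p with hκdef
  have hδ : 0 < r / ρ := div_pos hr hρ
  have hG0 : Gstar A h 0 = abar := by
    refine le_antisymm (Gstar_le hne fun a ha => ?_) ?_
    · simpa using habar.2 ha
    · simpa using le_Gstar hA hhcont habar.1 0
  have hGmono := monotone_Gstar hA hne hhcont hhpos
  have hGnn : ∀ q, 0 ≤ Gstar A h q := fun q => by
    simpa [hh0] using le_Gstar hA hhcont hA0 q
  have hGle : ∀ q, q ≤ 0 → Gstar A h q ≤ abar := fun q hq => hG0 ▸ hGmono hq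
  have hq : ∀ lam, 0 ≤ lam → ∀ t, -(r / ρ) * lam * exp ((ρ - r) * t) ≤ 0 := by
    intro lam hlam t
    have : 0 ≤ r / ρ * lam * exp ((ρ - r) * t) := by positivity
    linarith
  have hexp : ∀ b : ℝ, 0 < b → IntegrableOn (fun t => exp (-b * t)) (Ioi 0) :=
    fun b hb => exp_neg_integrableOn_Ioi 0 hb
  have hexpI : ∀ b : ℝ, 0 < b → ∫ t in Ioi (0 : ℝ), exp (-b * t) = 1 / b := by
    intro b hb
    rw [integral_exp_mul_Ioi (neg_lt_zero.mpr hb)]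
    simp
  have hint : ∀ lam, 0 ≤ lam → IntegrableOn
      (fun t => ρ * exp (-(ρ * t)) *
        (Gstar A h (-(r / ρ) * lam * exp ((ρ - r) * t))
          - Fs (-(r / ρ) * lam * exp ((ρ - r) * t)))) (Ioi 0) := by
    intro lam hlam
    have hFc : Continuous fun t => Fs (-(r / ρ) * lam * exp ((ρ - r) * t)) :=
      hFscont.comp_continuous (by fun_prop) (hq lam hlam)
    have hdom : IntegrableOn (fun t => ρ * (abar + c₀ + c₁) * exp (-ρ * t)
        + ρ * c₀ * (r / ρ * lam) ^ p * exp (-κ * t)) (Ioi 0) :=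
      ((hexp ρ hρ).const_mul _).add ((hexp κ hκ).const_mul _)
    refine hdom.mono' ?_ (ae_of_all _ fun t => ?_)
    · have hGm : Measurable fun t => Gstar A h (-(r / ρ) * lam * exp ((ρ - r) * t)) :=
        hGmono.measurable.comp (by fun_prop)
      have hm : Measurable fun t => ρ * exp (-(ρ * t)) *
          (Gstar A h (-(r / ρ) * lam * exp ((ρ - r) * t))
            - Fs (-(r / ρ) * lam * exp ((ρ - r) * t))) :=
        Measurable.mul (by fun_prop) (hGm.sub hFc.measurable)
      exact hm.aestronglyMeasurable
    · have e1 := discounted_rpow_eq hr hρ hlam p t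
      rw [← hκdef] at e1
      rw [mul_assoc (ρ * c₀), ← e1, neg_mul ρ t]
      have hq' := hq lam hlam t
      generalize -(r / ρ) * lam * exp ((ρ - r) * t) = q at *
      have b1 := hFslb q hq'
      have b2 := hFsub q hq'
      have b3 := hGnn q
      have b4 := hGle q hq'
      have b5 : 0 ≤ |q| ^ p := rpow_nonneg (abs_nonneg q) p
      have hw : 0 < ρ * exp (-(ρ * t)) := by positivity
      rw [norm_mul, norm_of_nonneg hw.le, Real.norm_eq_abs]
      have b6 : |Gstar A h q - Fs q| ≤ abar + c₀ + c₁ + c₀ * |q| ^ p := by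
        rw [abs_le]
        constructor <;> nlinarith [mul_nonneg hc₀.le b5, mul_nonneg hc₁.le b5]
      have b7 := mul_le_mul_of_nonneg_left b6 hw.le
      linarith
  refine ⟨hint, ?_, ?_, ?_⟩
  · have hH : StrictConvexOn ℝ (Iic 0) (fun q => Gstar A h q - Fs q) := by
      have h1 := ((convexOn_Gstar hA hne hhcont).subset (subset_univ _)
        (convex_Iic (0 : ℝ))).add_strictConvexOn hFsconc.neg
      simpa only [sub_eq_add_neg] using! h1
    have harg : ∀ x t, -(r / ρ) * x * exp ((ρ - r) * t)
        = x * (-(r / ρ) * exp ((ρ - r) * t)) := fun x t => by ring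
    have hs := strictConvexOn_integral_weight hH (w := fun t => ρ * exp (-(ρ * t)))
      (e := fun t => -(r / ρ) * exp ((ρ - r) * t)) (fun t => by positivity)
      (fun t => mul_neg_of_neg_of_pos (neg_lt_zero.mpr hδ) (exp_pos _))
      (fun x hx => by simpa only [harg] using hint x hx)
    have hφ : phiFB r ρ A h Fs = fun x => ∫ t in Ioi (0 : ℝ), ρ * exp (-(ρ * t)) *
        (Gstar A h (x * (-(r / ρ) * exp ((ρ - r) * t)))
          - Fs (x * (-(r / ρ) * exp ((ρ - r) * t)))) := by
      funext x
      simp only [phiFB, harg]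
    rw [hφ]
    exact hs
  · have e1 : ∀ t, ρ * exp (-(ρ * t)) *
        (Gstar A h (-(r / ρ) * 0 * exp ((ρ - r) * t))
          - Fs (-(r / ρ) * 0 * exp ((ρ - r) * t))) = ρ * abar * exp (-ρ * t) := by
      intro t
      rw [mul_zero, zero_mul, hG0, hFs0, neg_mul]
      ring
    simp only [phiFB, e1]
    rw [integral_const_mul, hexpI ρ hρ]
    field_simp
  · have hlow : ∀ lam, 0 ≤ lam →
        -c₁ + c₁ * ρ / κ * (r / ρ * lam) ^ p ≤ phiFB r ρ A h Fs lam := by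
      intro lam hlam
      have i1 := (hexp ρ hρ).const_mul (-(ρ * c₁))
      have i2 := (hexp κ hκ).const_mul (ρ * c₁ * (r / ρ * lam) ^ p)
      have e2 : ∫ t in Ioi (0 : ℝ), (-(ρ * c₁) * exp (-ρ * t)
          + ρ * c₁ * (r / ρ * lam) ^ p * exp (-κ * t))
          = -c₁ + c₁ * ρ / κ * (r / ρ * lam) ^ p := by
        rw [integral_add i1 i2, integral_const_mul, integral_const_mul, hexpI ρ hρ, hexpI κ hκ]
        field_simp
      rw [← e2]
      refine integral_mono (i1.add i2) (hint lam hlam) fun t => ?_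
      have e1 := discounted_rpow_eq hr hρ hlam p t
      rw [← hκdef] at e1
      simp only []
      rw [mul_assoc (ρ * c₁), ← e1, neg_mul ρ t]
      have hq' := hq lam hlam t
      generalize -(r / ρ) * lam * exp ((ρ - r) * t) = q at *
      have hw : 0 < ρ * exp (-(ρ * t)) := by positivity
      have b1 : -c₁ + c₁ * |q| ^ p ≤ Gstar A h q - Fs q := by
        linarith [hFsub q hq', hGnn q]
      have b2 := mul_le_mul_of_nonneg_left b1 hw.le
      linarith
    refine tendsto_atTop_mono' atTop
      ((eventually_ge_atTop 0).mono fun lam hlam => hlow lam hlam) ?_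
    refine tendsto_atTop_add_const_left _ _ (Tendsto.const_mul_atTop (by positivity) ?_)
    exact (tendsto_rpow_atTop hp0).comp (tendsto_id.const_mul_atTop hδ)
end

section
/- Let γ > 1, γ′ := γ/(γ−1), and r, ρ > 0 with ρ < γr; set δ := r/ρ. Let g : (−∞,0] → ℝ be continuously differentiable with |g(q)| + |q|·|g′(q)| ≤ C(1+|q|^{γ′}) for all q ≤ 0, for some C > 0, and define φ(λ) := ∫₀^∞ ρe^{−ρt}·g(−δλe^{(ρ−r)t}) dt for λ ≥ 0. Then φ is finite and differentiable on (0,∞), and for every λ > 0 one has the identity λ(1−δ)·φ′(λ) = φ(λ) − g(−δλ). -/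
open MeasureTheory Real Set

/-- The dual value `φ(λ) = ∫₀^∞ ρ e^{-ρt} g(-δ λ e^{(ρ-r)t}) dt` with `δ := r/ρ`. -/
noncomputable def phiG (r ρ : ℝ) (g : ℝ → ℝ) (lam : ℝ) : ℝ :=
  ∫ t in Set.Ioi (0:ℝ), ρ * Real.exp (-(ρ * t)) * g (-(r / ρ) * lam * Real.exp ((ρ - r) * t))

/-- The exponential rate at which `e^{-ρt} (e^{(ρ-r)t})^{γ/(γ-1)}` decays is positive. -/
lemma sub_conjExponent_mul_sub_pos {γ r ρ : ℝ} (hγ : 1 < γ) (hργ : ρ < γ * r) :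
    0 < ρ - γ / (γ - 1) * (ρ - r) := by
  have h : 0 < γ - 1 := sub_pos.2 hγ
  have : ρ - γ / (γ - 1) * (ρ - r) = (γ * r - ρ) / (γ - 1) := by
    field_simp
    ring
  rw [this]
  exact div_pos (sub_pos.2 hργ) h

/-- A discounted power-growth bound along `t ↦ -a e^{st}`, uniform in `0 ≤ a ≤ A`. -/
lemma exp_neg_mul_one_add_rpow_le {a A p : ℝ} (ha : 0 ≤ a) (haA : a ≤ A) (hp : 0 ≤ p)
    (ρ s t : ℝ) :
    exp (-(ρ * t)) * (1 + |-a * exp (s * t)| ^ p)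
      ≤ exp (-ρ * t) + A ^ p * exp (-(ρ - p * s) * t) := by
  have h1 : |-a * exp (s * t)| = a * exp (s * t) := by
    rw [neg_mul, abs_neg, abs_of_nonneg (by positivity)]
  have h2 : exp (-(ρ - p * s) * t) = exp (-(ρ * t)) * exp (s * t) ^ p := by
    rw [← exp_mul, ← exp_add]
    ring_nf
  rw [h1, mul_rpow ha (exp_pos _).le, h2, mul_add, mul_one, neg_mul]
  have h3 : a ^ p ≤ A ^ p := rpow_le_rpow ha haA hp
  have : exp (-(ρ * t)) * (a ^ p * exp (s * t) ^ p)
      ≤ exp (-(ρ * t)) * (A ^ p * exp (s * t) ^ p) := by gcongr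
  linarith

/-- If `|h q| ≤ C (1 + |q| ^ p)` on the negative axis, then `e^{-ρt} h(-a e^{st})` is dominated by
a sum of two exponentials, uniformly in `0 < a ≤ A`. -/
lemma abs_exp_neg_mul_le {h : ℝ → ℝ} {C p : ℝ} (hC : 0 ≤ C) (hp : 0 ≤ p)
    (hh : ∀ q < 0, |h q| ≤ C * (1 + |q| ^ p)) {a A : ℝ} (ha : 0 < a) (haA : a ≤ A) (ρ s t : ℝ) :
    |exp (-(ρ * t)) * h (-a * exp (s * t))|
      ≤ C * (exp (-ρ * t) + A ^ p * exp (-(ρ - p * s) * t)) := by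
  have hq : -a * exp (s * t) < 0 := mul_neg_of_neg_of_pos (neg_neg_iff_pos.2 ha) (exp_pos _)
  rw [abs_mul, abs_of_pos (exp_pos _)]
  calc exp (-(ρ * t)) * |h (-a * exp (s * t))|
      ≤ exp (-(ρ * t)) * (C * (1 + |-a * exp (s * t)| ^ p)) := by gcongr; exact hh _ hq
    _ = C * (exp (-(ρ * t)) * (1 + |-a * exp (s * t)| ^ p)) := by ring
    _ ≤ _ := mul_le_mul_of_nonneg_left (exp_neg_mul_one_add_rpow_le ha.le haA hp ρ s t) hC

lemma integrableOn_exp_add_exp {ρ c : ℝ} (hρ : 0 < ρ) (hc : 0 < c) (C K : ℝ) :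
    IntegrableOn (fun t => C * (exp (-ρ * t) + K * exp (-c * t))) (Ioi 0) :=
  ((exp_neg_integrableOn_Ioi 0 hρ).add ((exp_neg_integrableOn_Ioi 0 hc).const_mul K)).const_mul C

lemma tendsto_exp_add_exp {ρ c : ℝ} (hρ : 0 < ρ) (hc : 0 < c) (C K : ℝ) :
    Filter.Tendsto (fun t => C * (exp (-ρ * t) + K * exp (-c * t))) Filter.atTop (nhds 0) := by
  have key : ∀ b : ℝ, 0 < b → Filter.Tendsto (fun t => exp (-b * t)) Filter.atTop (nhds 0) :=
    fun b hb => tendsto_exp_atBot.comp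
      (Filter.tendsto_id.const_mul_atTop_of_neg (neg_neg_iff_pos.2 hb))
  simpa using ((key ρ hρ).add ((key c hc).const_mul K)).const_mul C

lemma continuous_exp_neg_mul_comp {h : ℝ → ℝ} (hh : ContinuousOn h (Iio 0)) {a : ℝ} (ha : 0 < a)
    (ρ s : ℝ) : Continuous fun t => exp (-(ρ * t)) * h (-a * exp (s * t)) :=
  (by fun_prop : Continuous fun t : ℝ => exp (-(ρ * t))).mul <|
    hh.comp_continuous (by fun_prop) fun _ =>
      mul_neg_of_neg_of_pos (neg_neg_iff_pos.2 ha) (exp_pos _)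

lemma integrableOn_exp_neg_mul_comp {h : ℝ → ℝ} {C p ρ s : ℝ} (hC : 0 ≤ C) (hp : 0 ≤ p)
    (hρ : 0 < ρ) (hs : 0 < ρ - p * s) (hcont : ContinuousOn h (Iio 0))
    (hh : ∀ q < 0, |h q| ≤ C * (1 + |q| ^ p)) {a : ℝ} (ha : 0 < a) :
    IntegrableOn (fun t => exp (-(ρ * t)) * h (-a * exp (s * t))) (Ioi 0) :=
  (integrableOn_exp_add_exp hρ hs C (a ^ p)).mono'
    (continuous_exp_neg_mul_comp hcont ha ρ s).aestronglyMeasurable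
    (.of_forall fun t => abs_exp_neg_mul_le hC hp hh ha le_rfl ρ s t)

/-- Integration by parts for the discounted integral along `t ↦ -a e^{st}`. -/
lemma integral_exp_neg_mul_comp_eq {g g' : ℝ → ℝ} {C p ρ s : ℝ} (hC : 0 ≤ C) (hp : 0 ≤ p)
    (hρ : 0 < ρ) (hs : 0 < ρ - p * s) (hg : ∀ q < 0, HasDerivAt g (g' q) q)
    (hg' : ContinuousOn g' (Iio 0)) (hb : ∀ q < 0, |g q| ≤ C * (1 + |q| ^ p))
    (hb' : ∀ q < 0, |q * g' q| ≤ C * (1 + |q| ^ p)) {a : ℝ} (ha : 0 < a) :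
    s * ∫ t in Ioi 0, exp (-(ρ * t)) * ((-a * exp (s * t)) * g' (-a * exp (s * t)))
      = ρ * (∫ t in Ioi 0, exp (-(ρ * t)) * g (-a * exp (s * t))) - g (-a) := by
  have hcont : ContinuousOn g (Iio 0) := fun q hq => (hg q hq).continuousAt.continuousWithinAt
  have hI := integrableOn_exp_neg_mul_comp hC hp hρ hs hcont hb ha
  have hI' := integrableOn_exp_neg_mul_comp (h := fun q => q * g' q) hC hp hρ hs
    (continuousOn_id.mul hg') hb' ha
  have hderiv : ∀ t : ℝ, HasDerivAt (fun t => exp (-(ρ * t)) * g (-a * exp (s * t)))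
      (s * (exp (-(ρ * t)) * ((-a * exp (s * t)) * g' (-a * exp (s * t))))
        - ρ * (exp (-(ρ * t)) * g (-a * exp (s * t)))) t := by
    intro t
    have hq : HasDerivAt (fun t => -a * exp (s * t)) (-a * (exp (s * t) * (s * 1))) t :=
      (((hasDerivAt_id t).const_mul s).exp).const_mul (-a)
    have he : HasDerivAt (fun t => exp (-(ρ * t))) (exp (-(ρ * t)) * -(ρ * 1)) t :=
      (((hasDerivAt_id t).const_mul ρ).neg).exp
    have hlt : -a * exp (s * t) < 0 := mul_neg_of_neg_of_pos (neg_neg_iff_pos.2 ha) (exp_pos _)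
    refine (he.mul ((hg _ hlt).comp t hq)).congr_deriv ?_
    simp only [Function.comp_apply]
    ring
  have htend : Filter.Tendsto (fun t => exp (-(ρ * t)) * g (-a * exp (s * t)))
      Filter.atTop (nhds 0) :=
    squeeze_zero_norm (fun t => abs_exp_neg_mul_le hC hp hb ha le_rfl ρ s t)
      (tendsto_exp_add_exp hρ hs C (a ^ p))
  have hFTC := integral_Ioi_of_hasDerivAt_of_tendsto (hderiv 0).continuousAt.continuousWithinAt
    (fun t _ => hderiv t) ((hI'.const_mul s).sub (hI.const_mul ρ)) htend
  rw [integral_sub (hI'.const_mul s) (hI.const_mul ρ), integral_const_mul,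
    integral_const_mul] at hFTC
  simp only [mul_zero, neg_zero, exp_zero, one_mul, mul_one] at hFTC
  linarith

/-- Differentiation under the discounted integral with respect to the starting point. -/
lemma hasDerivAt_integral_exp_neg_mul_comp {g g' : ℝ → ℝ} {C p ρ s : ℝ} (hC : 0 ≤ C)
    (hp : 0 ≤ p) (hρ : 0 < ρ) (hs : 0 < ρ - p * s) (hg : ∀ q < 0, HasDerivAt g (g' q) q)
    (hg' : ContinuousOn g' (Iio 0)) (hb : ∀ q < 0, |g q| ≤ C * (1 + |q| ^ p))
    (hb' : ∀ q < 0, |q * g' q| ≤ C * (1 + |q| ^ p)) {a : ℝ} (ha : 0 < a) :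
    HasDerivAt (fun x => ∫ t in Ioi 0, exp (-(ρ * t)) * g (-x * exp (s * t)))
      (a⁻¹ * ∫ t in Ioi 0, exp (-(ρ * t)) * ((-a * exp (s * t)) * g' (-a * exp (s * t)))) a := by
  have hcont : ContinuousOn g (Iio 0) := fun q hq => (hg q hq).continuousAt.continuousWithinAt
  have hcont' : ContinuousOn (fun q => q * g' q) (Iio 0) := continuousOn_id.mul hg'
  have hpos : ∀ x ∈ Ioo (a / 2) (2 * a), 0 < x := fun x hx => (half_pos ha).trans hx.1
  rw [← integral_const_mul]
  refine (hasDerivAt_integral_of_dominated_loc_of_deriv_le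
    (μ := volume.restrict (Ioi 0))
    (F := fun x t => exp (-(ρ * t)) * g (-x * exp (s * t)))
    (F' := fun x t => x⁻¹ * (exp (-(ρ * t)) * ((-x * exp (s * t)) * g' (-x * exp (s * t)))))
    (bound := fun t => (a / 2)⁻¹ *
      (C * (exp (-ρ * t) + (2 * a) ^ p * exp (-(ρ - p * s) * t))))
    (Ioo_mem_nhds (by linarith : a / 2 < a) (by linarith : a < 2 * a)) ?_
    (integrableOn_exp_neg_mul_comp hC hp hρ hs hcont hb ha) ?_ (.of_forall fun t x hx => ?_)
    ((integrableOn_exp_add_exp hρ hs C ((2 * a) ^ p)).const_mul _)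
    (.of_forall fun t x hx => ?_)).2
  · filter_upwards [lt_mem_nhds ha] with x hx
    exact (continuous_exp_neg_mul_comp hcont hx ρ s).aestronglyMeasurable
  · exact ((continuous_exp_neg_mul_comp hcont' ha ρ s).const_mul a⁻¹).aestronglyMeasurable
  · rw [norm_mul, norm_of_nonneg (inv_nonneg.2 (hpos x hx).le)]
    exact mul_le_mul (inv_anti₀ (half_pos ha) hx.1.le)
      (abs_exp_neg_mul_le (h := fun q => q * g' q) hC hp hb' (hpos x hx) hx.2.le ρ s t)
      (norm_nonneg _) (by positivity)
  · have hx0 := hpos x hx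
    have hq : HasDerivAt (fun x => -x * exp (s * t)) (-1 * exp (s * t)) x :=
      (hasDerivAt_id x).neg.mul_const _
    have hlt : -x * exp (s * t) < 0 := mul_neg_of_neg_of_pos (neg_neg_iff_pos.2 hx0) (exp_pos _)
    refine (((hg _ hlt).comp x hq).const_mul (exp (-(ρ * t)))).congr_deriv ?_
    field_simp

/-- If `g` is `C¹` on `(-∞,0]` with `|g(q)| + |q||g'(q)| ≤ C(1+|q|^{γ/(γ-1)})` and
`ρ < γ r`, then `φ` is finite and differentiable on `(0,∞)` and satisfies
`λ(1-δ) φ'(λ) = φ(λ) - g(-δλ)` for every `λ > 0`, where `δ := r/ρ`. -/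
theorem dual_value_derivative_identity
    (γ r ρ C : ℝ) (hγ : 1 < γ) (hr : 0 < r) (hρ : 0 < ρ) (hργ : ρ < γ * r) (hC : 0 < C)
    (g g' : ℝ → ℝ)
    (hg : ∀ q ∈ Set.Iic (0:ℝ), HasDerivWithinAt g (g' q) (Set.Iic 0) q)
    (hg'cont : ContinuousOn g' (Set.Iic 0))
    (hbound : ∀ q, q ≤ 0 → |g q| + |q| * |g' q| ≤ C * (1 + |q| ^ (γ / (γ - 1)))) :
    (∀ lam, 0 < lam → MeasureTheory.IntegrableOn
      (fun t => ρ * Real.exp (-(ρ * t)) * g (-(r / ρ) * lam * Real.exp ((ρ - r) * t)))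
      (Set.Ioi 0)) ∧
    ∀ lam, 0 < lam → DifferentiableAt ℝ (phiG r ρ g) lam ∧
      lam * (1 - r / ρ) * deriv (phiG r ρ g) lam
        = phiG r ρ g lam - g (-(r / ρ) * lam) := by
  have hγ1 : 0 < γ - 1 := sub_pos.2 hγ
  have hp : 0 ≤ γ / (γ - 1) := by positivity
  have hs := sub_conjExponent_mul_sub_pos hγ hργ
  have hδ : 0 < r / ρ := div_pos hr hρ
  have hgd : ∀ q < 0, HasDerivAt g (g' q) q := fun q hq =>
    (hg q hq.le).hasDerivAt (Iic_mem_nhds hq)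
  have hcont : ContinuousOn g (Iio 0) := fun q hq => (hgd q hq).continuousAt.continuousWithinAt
  have hg' : ContinuousOn g' (Iio 0) := hg'cont.mono Iio_subset_Iic_self
  have hb : ∀ q < 0, |g q| ≤ C * (1 + |q| ^ (γ / (γ - 1))) := fun q hq =>
    (le_add_of_nonneg_right (by positivity)).trans (hbound q hq.le)
  have hb' : ∀ q < 0, |q * g' q| ≤ C * (1 + |q| ^ (γ / (γ - 1))) := fun q hq => by
    rw [abs_mul]
    exact (le_add_of_nonneg_left (abs_nonneg _)).trans (hbound q hq.le)
  refine ⟨fun lam hlam => ?_, fun lam hlam => ?_⟩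
  · simp only [mul_assoc ρ, neg_mul (r / ρ)]
    exact (integrableOn_exp_neg_mul_comp hC.le hp hρ hs hcont hb (mul_pos hδ hlam)).const_mul ρ
  · have ha : 0 < r / ρ * lam := mul_pos hδ hlam
    have hphi : phiG r ρ g = fun x =>
        ρ * ∫ t in Ioi 0, exp (-(ρ * t)) * g (-(r / ρ * x) * exp ((ρ - r) * t)) := by
      funext x
      simp only [phiG, mul_assoc ρ, neg_mul (r / ρ), integral_const_mul]
    have hlin : HasDerivAt (fun x => r / ρ * x) (r / ρ * 1) lam :=
      (hasDerivAt_id lam).const_mul _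
    have hD : HasDerivAt (phiG r ρ g) _ lam := hphi ▸
      ((hasDerivAt_integral_exp_neg_mul_comp hC.le hp hρ hs hgd hg' hb hb' ha).comp lam
        hlin).const_mul ρ
    refine ⟨hD.differentiableAt, ?_⟩
    have hparts := integral_exp_neg_mul_comp_eq hC.le hp hρ hs hgd hg' hb hb' ha
    rw [hD.deriv, hphi, neg_mul]
    beta_reduce
    rw [← hparts]
    field_simp
end

section
/- Let γ > 1, γ′ := γ/(γ−1), and r, ρ > 0 with ρ < γr; set δ := r/ρ. Let g : (−∞,0] → ℝ be continuously differentiable and strictly convex with g(0) ≥ 0, g(q) ≥ c₀(|q|^{γ′} − 1) for all q ≤ 0 for some c₀ > 0, and |g(q)| + |q|·|g′(q)| ≤ C(1+|q|^{γ′}) for all q ≤ 0. Define φ(λ) := ∫₀^∞ ρe^{−ρt}·g(−δλe^{(ρ−r)t}) dt for λ ≥ 0. Let R₀ ≥ 0 satisfy R₀ > −g′(0). Then there exists a unique λ^⋆ > 0 with φ′(λ^⋆) = R₀, the infimum inf_{λ ≥ 0}{−λR₀ + φ(λ)} is attained at λ^⋆, and its value equals −δλ^⋆R₀ + g(−δλ^⋆).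 -/
open MeasureTheory Real Set

open Filter Topology

theorem StrictConvexOn.add_mul_sub_lt {S : Set ℝ} {f f' : ℝ → ℝ} (hf : StrictConvexOn ℝ S f)
    (hf' : ∀ x ∈ S, HasDerivWithinAt f (f' x) S x) {x y : ℝ} (hx : x ∈ S) (hy : y ∈ S)
    (hxy : x ≠ y) : f x + f' x * (y - x) < f y := by
  rcases lt_or_gt_of_ne hxy with h | h
  · have := hf.lt_slope_of_hasDerivWithinAt hx hy h (hf' x hx)
    rw [slope_def_field, lt_div_iff₀ (by linarith)] at this
    linarith
  · have := hf.slope_lt_of_hasDerivWithinAt hy hx h (hf' x hx)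
    rw [slope_def_field, div_lt_iff₀ (by linarith)] at this
    linarith

theorem StrictConvexOn.strictMonoOn_of_hasDerivWithinAt {S : Set ℝ} {f f' : ℝ → ℝ}
    (hf : StrictConvexOn ℝ S f) (hf' : ∀ x ∈ S, HasDerivWithinAt f (f' x) S x) :
    StrictMonoOn f' S := by
  intro x hx y hy hxy
  have h1 := hf.add_mul_sub_lt hf' hx hy hxy.ne
  have h2 := hf.add_mul_sub_lt hf' hy hx hxy.ne'
  have h3 : 0 < (f' y - f' x) * (y - x) := by linarith
  exact sub_pos.1 (pos_of_mul_pos_left h3 (by linarith))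

/-- A function on `[0,∞)` with a subgradient that is continuous at `x > 0` is differentiable
at `x`. -/
theorem hasDerivAt_of_subgradient {f m : ℝ → ℝ}
    (h : ∀ x, 0 < x → ∀ y, 0 ≤ y → f x + m x * (y - x) ≤ f y) {x : ℝ} (hx : 0 < x)
    (hm : ContinuousAt m x) : HasDerivAt f (m x) x := by
  rw [hasDerivAt_iff_isLittleO, Asymptotics.isLittleO_iff]
  intro ε hε
  filter_upwards [Metric.continuousAt_iff'.1 hm ε hε, lt_mem_nhds hx] with y hy hy0
  have h1 := h x hx y hy0.le
  have h2 := h y hy0 x hx.le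
  rw [Real.dist_eq] at hy
  simp only [smul_eq_mul, Real.norm_eq_abs]
  calc |f y - f x - (y - x) * m x| ≤ |(m y - m x) * (y - x)| := by
        rw [abs_of_nonneg (by linarith)]
        exact le_trans (by linarith) (le_abs_self _)
    _ ≤ ε * |y - x| := by
        rw [abs_mul]
        gcongr

theorem setIntegral_Ioi_pos {f : ℝ → ℝ} {a : ℝ} (hf : IntegrableOn f (Ioi a))
    (hpos : ∀ t ∈ Ioi a, 0 < f t) : 0 < ∫ t in Ioi a, f t := by
  rw [setIntegral_pos_iff_support_of_nonneg_ae
    ((ae_restrict_iff' measurableSet_Ioi).2 (ae_of_all _ fun t ht => (hpos t ht).le)) hf]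
  have : Function.support f ∩ Ioi a = Ioi a :=
    inter_eq_right.2 fun t ht => (hpos t ht).ne'
  simp [this]

/-- The present value, discounted at rate `β`, of `h` along the path `t ↦ -a e^{kt}`. -/
noncomputable def presentValue (β k : ℝ) (h : ℝ → ℝ) (a : ℝ) : ℝ :=
  ∫ t in Ioi (0:ℝ), Real.exp (-(β * t)) * h (-(a * Real.exp (k * t)))

section PresentValue

variable {β k s K a : ℝ} {h : ℝ → ℝ}

theorem neg_mul_exp_nonpos (ha : 0 ≤ a) (t : ℝ) : -(a * Real.exp (k * t)) ≤ 0 :=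
  neg_nonpos.2 (by positivity)

theorem continuous_discounted (hc : ContinuousOn h (Iic 0)) (ha : 0 ≤ a) :
    Continuous fun t => Real.exp (-(β * t)) * h (-(a * Real.exp (k * t))) := by
  refine Continuous.mul (by fun_prop) ?_
  exact hc.comp_continuous (by fun_prop) fun t => neg_mul_exp_nonpos ha t

theorem abs_discounted_le {L : ℝ} (hs : 0 ≤ s) (hK : 0 ≤ K)
    (hb : ∀ q ≤ 0, |h q| ≤ K * (1 + |q| ^ s)) (ha : 0 ≤ a) (haL : a ≤ L) (t : ℝ) :
    |Real.exp (-(β * t)) * h (-(a * Real.exp (k * t)))|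
      ≤ K * (Real.exp (-β * t) + L ^ s * Real.exp ((s * k - β) * t)) := by
  have h1 := hb _ (neg_mul_exp_nonpos (k := k) ha t)
  rw [abs_neg, abs_of_nonneg (by positivity : 0 ≤ a * Real.exp (k * t))] at h1
  have h2 : (a * Real.exp (k * t)) ^ s ≤ L ^ s * Real.exp (s * k * t) := by
    rw [Real.mul_rpow ha (Real.exp_pos _).le, ← Real.exp_mul]
    rw [show k * t * s = s * k * t by ring]
    gcongr
  rw [abs_mul, abs_of_pos (Real.exp_pos _)]
  calc Real.exp (-(β * t)) * |h (-(a * Real.exp (k * t)))|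
      ≤ Real.exp (-(β * t)) * (K * (1 + L ^ s * Real.exp (s * k * t))) := by
        gcongr
        exact h1.trans (by gcongr)
    _ = _ := by
        rw [show (s * k - β) * t = -(β * t) + s * k * t by ring, Real.exp_add, neg_mul]
        ring

theorem integrableOn_discounted_bound (hβ : 0 < β) (hsk : s * k < β) (L : ℝ) :
    IntegrableOn (fun t => K * (Real.exp (-β * t) + L ^ s * Real.exp ((s * k - β) * t)))
      (Ioi 0) :=
  ((integrableOn_exp_mul_Ioi (by linarith) 0).add
    ((integrableOn_exp_mul_Ioi (by linarith) 0).const_mul _)).const_mul _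

theorem integrableOn_discounted (hβ : 0 < β) (hs : 0 ≤ s) (hsk : s * k < β) (hK : 0 ≤ K)
    (hc : ContinuousOn h (Iic 0)) (hb : ∀ q ≤ 0, |h q| ≤ K * (1 + |q| ^ s)) (ha : 0 ≤ a) :
    IntegrableOn (fun t => Real.exp (-(β * t)) * h (-(a * Real.exp (k * t)))) (Ioi 0) :=
  Integrable.mono' (integrableOn_discounted_bound hβ hsk a)
    (continuous_discounted hc ha).aestronglyMeasurable
    (ae_of_all _ fun t => abs_discounted_le hs hK hb ha le_rfl t)

theorem continuousOn_presentValue (hβ : 0 < β) (hs : 0 ≤ s) (hsk : s * k < β) (hK : 0 ≤ K)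
    (hc : ContinuousOn h (Iic 0)) (hb : ∀ q ≤ 0, |h q| ≤ K * (1 + |q| ^ s)) (L : ℝ) :
    ContinuousOn (presentValue β k h) (Icc 0 L) := by
  refine continuousOn_of_dominated
    (fun a ha => (continuous_discounted hc ha.1).aestronglyMeasurable)
    (fun a ha => ae_of_all _ fun t => abs_discounted_le hs hK hb ha.1 ha.2 t)
    (integrableOn_discounted_bound hβ hsk L) (ae_of_all _ fun t => ?_)
  refine ContinuousOn.mul continuousOn_const (hc.comp (by fun_prop) ?_)
  exact fun a ha => neg_mul_exp_nonpos ha.1 t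

theorem integral_exp_neg_mul_Ioi_zero (hβ : 0 < β) :
    ∫ t in Ioi (0:ℝ), Real.exp (-(β * t)) = 1 / β := by
  have := integral_exp_mul_Ioi (neg_lt_zero.2 hβ) 0
  simpa [neg_div_neg_eq] using this

theorem presentValue_zero (hβ : 0 < β) : presentValue β k h 0 = h 0 / β := by
  simp only [presentValue, zero_mul, neg_zero, integral_mul_const,
    integral_exp_neg_mul_Ioi_zero hβ]
  ring

end PresentValue

/-- A bound on `|q| |f q|` of order `p` yields a bound on `|f q|` of order `p - 1`. -/
theorem exists_abs_le_of_abs_mul_abs_le {f : ℝ → ℝ} {C p : ℝ} (hp : 1 ≤ p) (hC : 0 ≤ C)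
    (hc : ContinuousOn f (Iic 0)) (hb : ∀ q ≤ 0, |q| * |f q| ≤ C * (1 + |q| ^ p)) :
    ∃ K, 0 ≤ K ∧ ∀ q ≤ 0, |f q| ≤ K * (1 + |q| ^ (p - 1)) := by
  obtain ⟨A, hA⟩ := (isCompact_Icc (a := (-1:ℝ)) (b := 0)).exists_bound_of_continuousOn
    (hc.mono fun q hq => hq.2)
  refine ⟨|A| + 2 * C, by positivity, fun q hq => ?_⟩
  have hnn : 0 ≤ |q| ^ (p - 1) := by positivity
  rcases le_total (-1) q with h | h
  · have h1 : |f q| ≤ |A| := (hA q ⟨h, hq⟩).trans (le_abs_self A)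
    nlinarith [abs_nonneg A, mul_nonneg (abs_nonneg A) hnn, mul_nonneg hC hnn]
  · have h1 : 1 ≤ |q| := by rw [abs_of_nonpos hq]; linarith
    have h0 : 0 < |q| := by linarith
    have h2 : |q| ^ p = |q| * |q| ^ (p - 1) := by
      rw [Real.rpow_sub_one h0.ne']; field_simp
    have h3 : 1 ≤ |q| ^ p := Real.one_le_rpow h1 (by linarith)
    have h4 : |q| * |f q| ≤ |q| * (2 * C * |q| ^ (p - 1)) := by
      have := hb q hq
      nlinarith
    have h5 := le_of_mul_le_mul_left h4 h0
    nlinarith [abs_nonneg A, mul_nonneg (abs_nonneg A) hnn]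

/-- A power of exponent `p > 1` dominates every linear function up to a constant. -/
theorem exists_linear_le_rpow {p c : ℝ} (hp : 1 < p) (hc : 0 < c) {B : ℝ} (hB : 0 ≤ B) :
    ∃ D, 0 ≤ D ∧ ∀ x, 0 ≤ x → B * x - D ≤ c * (x ^ p - 1) := by
  have hpq := Real.HolderConjugate.conjExponent hp
  have hq := hpq.symm.pos
  refine ⟨c * (1 + (B / c) ^ p.conjExponent / p.conjExponent), by positivity, fun x hx => ?_⟩
  have h1 := Real.young_inequality_of_nonneg hx (by positivity : 0 ≤ B / c) hpq
  have h2 : x ^ p / p ≤ x ^ p := div_le_self (by positivity) hp.le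
  have h3 : c * (x * (B / c)) = B * x := by field_simp
  nlinarith

section Dual

variable {ρ k a b : ℝ} {g g' : ℝ → ℝ}

theorem presentValue_add_mul_sub_le (hg : ∀ q ∈ Iic (0:ℝ), HasDerivWithinAt g (g' q) (Iic 0) q)
    (hconv : StrictConvexOn ℝ (Iic 0) g) (ha : 0 ≤ a) (hb : 0 ≤ b)
    (hga : IntegrableOn (fun t => Real.exp (-(ρ * t)) * g (-(a * Real.exp (k * t)))) (Ioi 0))
    (hgb : IntegrableOn (fun t => Real.exp (-(ρ * t)) * g (-(b * Real.exp (k * t)))) (Ioi 0))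
    (hg'a : IntegrableOn
      (fun t => Real.exp (-((ρ - k) * t)) * g' (-(a * Real.exp (k * t)))) (Ioi 0)) :
    presentValue ρ k g a - presentValue (ρ - k) k g' a * (b - a) ≤ presentValue ρ k g b := by
  unfold presentValue
  rw [← integral_mul_const, ← integral_sub hga (hg'a.mul_const _)]
  refine integral_mono (hga.sub (hg'a.mul_const _)) hgb fun t => ?_
  have h1 : g (-(a * Real.exp (k * t))) + g' (-(a * Real.exp (k * t)))
      * (-(b * Real.exp (k * t)) - -(a * Real.exp (k * t))) ≤ g (-(b * Real.exp (k * t))) := by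
    by_cases hab : -(a * Real.exp (k * t)) = -(b * Real.exp (k * t))
    · rw [hab]; simp
    · exact (hconv.add_mul_sub_lt hg (neg_mul_exp_nonpos ha t) (neg_mul_exp_nonpos hb t) hab).le
  have h2 : Real.exp (-((ρ - k) * t)) = Real.exp (-(ρ * t)) * Real.exp (k * t) := by
    rw [← Real.exp_add]; congr 1; ring
  have h3 := mul_le_mul_of_nonneg_left h1 (Real.exp_pos (-(ρ * t))).le
  refine le_trans (le_of_eq ?_) h3
  simp only [h2]
  ring

/-- Integration by parts along the discounted path. -/
theorem eq_presentValue_add (hg : ∀ q ∈ Iic (0:ℝ), HasDerivWithinAt g (g' q) (Iic 0) q)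
    (ha : 0 < a)
    (hga : IntegrableOn (fun t => Real.exp (-(ρ * t)) * g (-(a * Real.exp (k * t)))) (Ioi 0))
    (hg'a : IntegrableOn
      (fun t => Real.exp (-((ρ - k) * t)) * g' (-(a * Real.exp (k * t)))) (Ioi 0)) :
    g (-a) = ρ * presentValue ρ k g a + a * k * presentValue (ρ - k) k g' a := by
  have hd : ∀ t : ℝ, HasDerivAt (fun t => Real.exp (-(ρ * t)) * g (-(a * Real.exp (k * t))))
      ((-ρ) * (Real.exp (-(ρ * t)) * g (-(a * Real.exp (k * t))))
        + (-(a * k)) * (Real.exp (-((ρ - k) * t)) * g' (-(a * Real.exp (k * t))))) t := by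
    intro t
    have hneg : -(a * Real.exp (k * t)) < 0 := neg_lt_zero.2 (by positivity)
    have h1 : HasDerivAt g (g' (-(a * Real.exp (k * t)))) (-(a * Real.exp (k * t))) :=
      (hg _ hneg.le).hasDerivAt (Iic_mem_nhds hneg)
    have h2 : HasDerivAt (fun t => -(a * Real.exp (k * t))) (-(a * (Real.exp (k * t) * k))) t := by
      simpa using ((((hasDerivAt_id t).const_mul k).exp).const_mul a).fun_neg
    have h3 : HasDerivAt (fun t => Real.exp (-(ρ * t))) (Real.exp (-(ρ * t)) * -ρ) t := by
      simpa using (((hasDerivAt_id t).const_mul ρ).neg).exp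
    refine (h3.mul (h1.comp t h2)).congr_deriv ?_
    have h4 : Real.exp (-((ρ - k) * t)) = Real.exp (-(ρ * t)) * Real.exp (k * t) := by
      rw [← Real.exp_add]; congr 1; ring
    rw [h4, Function.comp_apply]
    ring
  have hint := (hga.const_mul (-ρ)).add (hg'a.const_mul (-(a * k)))
  have h0 := integral_Ioi_of_hasDerivAt_of_tendsto' (a := 0) (fun t _ => hd t) hint
    (tendsto_zero_of_hasDerivAt_of_integrableOn_Ioi (a := 0) (fun t _ => hd t) hint hga)
  rw [integral_add (hga.const_mul (-ρ)) (hg'a.const_mul (-(a * k))), integral_const_mul,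
    integral_const_mul] at h0
  simp only [mul_zero, neg_zero, Real.exp_zero, one_mul, mul_one] at h0
  unfold presentValue
  linarith

theorem presentValue_strictAnti {β : ℝ} (hmono : StrictMonoOn g' (Iic 0)) (ha : 0 ≤ a)
    (hab : a < b)
    (hia : IntegrableOn (fun t => Real.exp (-(β * t)) * g' (-(a * Real.exp (k * t)))) (Ioi 0))
    (hib : IntegrableOn (fun t => Real.exp (-(β * t)) * g' (-(b * Real.exp (k * t)))) (Ioi 0)) :
    presentValue β k g' b < presentValue β k g' a := by
  unfold presentValue
  rw [← sub_pos, ← integral_sub hia hib]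
  refine setIntegral_Ioi_pos (hia.sub hib) fun t _ => ?_
  have := hmono (neg_mul_exp_nonpos (k := k) (ha.trans hab.le) t) (neg_mul_exp_nonpos ha t)
    (neg_lt_neg (mul_lt_mul_of_pos_right hab (Real.exp_pos (k * t))))
  rw [← mul_sub]
  exact mul_pos (Real.exp_pos _) (sub_pos.2 this)

theorem presentValue_deriv_le (hρ : 0 < ρ) (hkρ : k < ρ)
    (hg : ∀ q ∈ Iic (0:ℝ), HasDerivWithinAt g (g' q) (Iic 0) q)
    (hconv : StrictConvexOn ℝ (Iic 0) g) {B D : ℝ} (hlin : ∀ q ≤ 0, B * |q| - D ≤ g q)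
    (ha : 0 < a)
    (hg'a : IntegrableOn
      (fun t => Real.exp (-((ρ - k) * t)) * g' (-(a * Real.exp (k * t)))) (Ioi 0)) :
    presentValue (ρ - k) k g' a ≤ -B / (ρ - k) + (D + g 0) / (a * ρ) := by
  have hE1 : IntegrableOn (fun t => Real.exp (-((ρ - k) * t))) (Ioi 0) := by
    simpa only [neg_mul] using integrableOn_exp_mul_Ioi (a := -(ρ - k)) (by linarith) 0
  have hE2 : IntegrableOn (fun t => Real.exp (-(ρ * t))) (Ioi 0) := by
    simpa only [neg_mul] using integrableOn_exp_mul_Ioi (a := -ρ) (by linarith) 0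
  have hi := (hE1.const_mul (-B)).add (hE2.const_mul ((D + g 0) / a))
  have hle : presentValue (ρ - k) k g' a ≤ ∫ t in Ioi (0:ℝ),
      (-B * Real.exp (-((ρ - k) * t)) + (D + g 0) / a * Real.exp (-(ρ * t))) := by
    refine integral_mono hg'a hi fun t => ?_
    have hx : 0 < a * Real.exp (k * t) := by positivity
    have h1 := hconv.add_mul_sub_lt hg (x := -(a * Real.exp (k * t))) (y := 0)
      (neg_mul_exp_nonpos ha.le t) (mem_Iic.2 le_rfl) (neg_lt_zero.2 hx).ne
    have h2 := hlin _ (neg_mul_exp_nonpos (k := k) ha.le t)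
    rw [abs_neg, abs_of_pos hx] at h2
    have h3 : g' (-(a * Real.exp (k * t))) ≤ -B + (D + g 0) / (a * Real.exp (k * t)) := by
      rw [← sub_le_iff_le_add', le_div_iff₀ hx]
      linarith
    have h4 : Real.exp (-((ρ - k) * t)) = Real.exp (-(ρ * t)) * Real.exp (k * t) := by
      rw [← Real.exp_add]; congr 1; ring
    refine (mul_le_mul_of_nonneg_left h3 (Real.exp_pos _).le).trans (le_of_eq ?_)
    simp only [h4]
    field_simp
  refine hle.trans (le_of_eq ?_)
  rw [integral_add (hE1.const_mul _) (hE2.const_mul _), integral_const_mul, integral_const_mul,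
    integral_exp_neg_mul_Ioi_zero (sub_pos.2 hkρ), integral_exp_neg_mul_Ioi_zero hρ]
  field_simp

end Dual

theorem phiG_eq_presentValue (r ρ : ℝ) (g : ℝ → ℝ) (lam : ℝ) :
    phiG r ρ g lam = ρ * presentValue ρ (ρ - r) g (r / ρ * lam) := by
  unfold phiG presentValue
  rw [← integral_const_mul]
  simp only [neg_mul, mul_assoc]

/-- First-best optimal multiplier: with `ρ < γ r`, `δ := r/ρ`, `g` a `C¹`, strictly
convex function on `(-∞,0]` with `g(0) ≥ 0`, coercive growth
`g(q) ≥ c₀(|q|^{γ/(γ-1)} - 1)`, the bound `|g(q)| + |q||g'(q)| ≤ C(1+|q|^{γ/(γ-1)})`,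
and a reservation level `R₀ ≥ 0` with `R₀ > -g'(0)`, there is a unique `λ⋆ > 0` with
`φ'(λ⋆) = R₀`; the infimum `inf_{λ ≥ 0} {-λ R₀ + φ(λ)}` is attained at `λ⋆`, and its
value is `-δ λ⋆ R₀ + g(-δ λ⋆)`. -/
theorem firstbest_optimal_multiplier
    (γ r ρ C c₀ : ℝ) (hγ : 1 < γ) (hr : 0 < r) (hρ : 0 < ρ) (hργ : ρ < γ * r)
    (hC : 0 < C) (hc₀ : 0 < c₀)
    (g g' : ℝ → ℝ)
    (hg : ∀ q ∈ Set.Iic (0:ℝ), HasDerivWithinAt g (g' q) (Set.Iic 0) q)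
    (hg'cont : ContinuousOn g' (Set.Iic 0))
    (hgconv : StrictConvexOn ℝ (Set.Iic 0) g)
    (hg0 : 0 ≤ g 0)
    (hglb : ∀ q, q ≤ 0 → c₀ * (|q| ^ (γ / (γ - 1)) - 1) ≤ g q)
    (hbound : ∀ q, q ≤ 0 → |g q| + |q| * |g' q| ≤ C * (1 + |q| ^ (γ / (γ - 1))))
    (R₀ : ℝ) (hR₀ : 0 ≤ R₀) (hR₀' : -g' 0 < R₀) :
    ∃ lstar : ℝ, 0 < lstar ∧ deriv (phiG r ρ g) lstar = R₀ ∧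
      (∀ l, 0 < l → deriv (phiG r ρ g) l = R₀ → l = lstar) ∧
      (∀ lam, 0 ≤ lam → -lstar * R₀ + phiG r ρ g lstar ≤ -lam * R₀ + phiG r ρ g lam) ∧
      -lstar * R₀ + phiG r ρ g lstar
        = -(r / ρ) * lstar * R₀ + g (-(r / ρ) * lstar) := by
  have hγ1 : 0 < γ - 1 := by linarith
  set p := γ / (γ - 1) with hp
  have hp1 : 1 < p := by rw [hp, one_lt_div hγ1]; linarith
  have hpk : p * (ρ - r) < ρ := by
    rw [hp, div_mul_eq_mul_div, div_lt_iff₀ hγ1]; linarith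
  have hgcont : ContinuousOn g (Iic 0) := fun q hq => (hg q hq).continuousWithinAt
  have hmono := hgconv.strictMonoOn_of_hasDerivWithinAt hg
  have hgb : ∀ q ≤ 0, |g q| ≤ C * (1 + |q| ^ p) := fun q hq =>
    le_trans (le_add_of_nonneg_right (by positivity)) (hbound q hq)
  obtain ⟨K, hK, hg'b⟩ := exists_abs_le_of_abs_mul_abs_le hp1.le hC.le hg'cont fun q hq =>
    le_trans (le_add_of_nonneg_left (abs_nonneg (g q))) (hbound q hq)
  have hrk : ρ - (ρ - r) = r := by ring
  have hp1k : (p - 1) * (ρ - r) < ρ - (ρ - r) := by linarith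
  have hβ : 0 < ρ - (ρ - r) := by linarith
  have hiF := fun a (ha : 0 ≤ a) =>
    integrableOn_discounted hρ (by linarith) hpk hC.le hgcont hgb ha
  have hiD := fun a (ha : 0 ≤ a) =>
    integrableOn_discounted hβ (by linarith) hp1k hK hg'cont hg'b ha
  have hδ : 0 < r / ρ := div_pos hr hρ
  set N : ℝ → ℝ := presentValue (ρ - (ρ - r)) (ρ - r) g' with hN
  set m : ℝ → ℝ := fun l => -r * N (r / ρ * l) with hm
  have hNcont : ∀ L, ContinuousOn N (Icc 0 L) :=
    continuousOn_presentValue hβ (by linarith) hp1k hK hg'cont hg'b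
  have hmcont : ∀ L, ContinuousOn m (Icc 0 L) := fun L =>
    continuousOn_const.mul ((hNcont (r / ρ * L)).comp (by fun_prop)
      fun l hl => ⟨mul_nonneg hδ.le hl.1, mul_le_mul_of_nonneg_left hl.2 hδ.le⟩)
  have hsub : ∀ x, 0 ≤ x → ∀ y, 0 ≤ y →
      phiG r ρ g x + m x * (y - x) ≤ phiG r ρ g y := by
    intro x hx y hy
    have hx' := mul_nonneg hδ.le hx
    have hy' := mul_nonneg hδ.le hy
    have h := mul_le_mul_of_nonneg_left (presentValue_add_mul_sub_le hg hgconv hx' hy'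
      (hiF _ hx') (hiF _ hy') (hiD _ hx')) hρ.le
    rw [phiG_eq_presentValue, phiG_eq_presentValue]
    refine le_trans (le_of_eq ?_) h
    simp only [hm, hN]
    field_simp
    ring
  have hderiv : ∀ l, 0 < l → deriv (phiG r ρ g) l = m l := fun l hl =>
    (hasDerivAt_of_subgradient (fun x hx => hsub x hx.le) hl
      ((hmcont (l + 1)).continuousAt (Icc_mem_nhds hl (by linarith)))).deriv
  have hmmono : ∀ x, 0 ≤ x → ∀ y, x < y → m x < m y := by
    intro x hx y hxy
    have h := presentValue_strictAnti hmono (mul_nonneg hδ.le hx)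
      (mul_lt_mul_of_pos_left hxy hδ) (hiD _ (mul_nonneg hδ.le hx))
      (hiD _ (mul_nonneg hδ.le (hx.trans hxy.le)))
    exact mul_lt_mul_of_neg_left h (neg_lt_zero.2 hr)
  have hm0 : m 0 = -g' 0 := by
    simp only [hm, hN, mul_zero]
    rw [presentValue_zero hβ, hrk]
    field_simp
  obtain ⟨D, hD, hlin⟩ := exists_linear_le_rpow hp1 hc₀ (by linarith : 0 ≤ R₀ + 1)
  set L := D + g 0 + 1 with hL
  have hL0 : 0 < L := by linarith
  have hmL : R₀ < m L := by
    have h := presentValue_deriv_le (k := ρ - r) hρ (by linarith) hg hgconv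
      (fun q hq => (hlin |q| (abs_nonneg q)).trans (hglb q hq)) (mul_pos hδ hL0)
      (hiD _ (mul_pos hδ hL0).le)
    have h1 : m L ≥ -r * (-(R₀ + 1) / (ρ - (ρ - r)) + (D + g 0) / (r / ρ * L * ρ)) :=
      mul_le_mul_of_nonpos_left h (neg_nonpos.2 hr.le)
    have h2 : -r * (-(R₀ + 1) / (ρ - (ρ - r)) + (D + g 0) / (r / ρ * L * ρ))
        = R₀ + 1 - (D + g 0) / L := by
      rw [hrk]
      field_simp
      ring
    have h3 : (D + g 0) / L < 1 := by rw [div_lt_one hL0]; linarith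
    linarith
  obtain ⟨l, hl, hml⟩ := intermediate_value_Icc hL0.le (hmcont L)
    (show R₀ ∈ Icc (m 0) (m L) from ⟨by linarith, hmL.le⟩)
  have hl0 : 0 < l := by
    refine lt_of_le_of_ne hl.1 ?_
    rintro rfl
    linarith
  refine ⟨l, hl0, (hderiv l hl0).trans hml, fun x hx hxd => ?_, fun x hx => ?_, ?_⟩
  · rw [hderiv x hx, ← hml] at hxd
    rcases lt_trichotomy x l with h | h | h
    · exact absurd hxd (hmmono x hx.le l h).ne
    · exact h
    · exact absurd hxd (hmmono l hl0.le x h).ne'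
  · have := hsub l hl0.le x hx
    rw [hml] at this
    linarith
  · have hδl := mul_pos hδ hl0
    have h := eq_presentValue_add hg hδl (hiF _ hδl.le) (hiD _ hδl.le)
    rw [neg_mul, neg_mul, h, phiG_eq_presentValue, ← hml]
    simp only [hm, hN]
    field_simp
    ring
end

section
/- Let h, σ, ψ, η > 0 and β ∈ [0,1]. Then ησ²h − (σ²hη+1)²/(σ²h(ψ+η)+1) − β(β−2) ≥ 0 if and only if β ≥ 1 − √( σ²hψ(1+σ²hη) / (1+σ²h(ψ+η)) ). (Equivalently, the discriminant identity 1 − [(σ²hη+1)²/(σ²h(ψ+η)+1) − ησ²h] = σ²hψ(1+σ²hη)/(1+σ²h(ψ+η)) holds, so the relevant quadratic in β has roots 1 ± √(σ²hψ(1+σ²hη)/(1+σ²h(ψ+η))).) -/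
open Real Set

/-- Sign condition for the Golden Parachute in the Holmström–Milgrom model with
early retirement: for `β ∈ [0,1]`,
`ησ²h - (σ²hη+1)²/(σ²h(ψ+η)+1) - β(β-2) ≥ 0` if and only if
`β ≥ 1 - √(σ²hψ(1+σ²hη)/(1+σ²h(ψ+η)))`; moreover the discriminant identity
`1 - [(σ²hη+1)²/(σ²h(ψ+η)+1) - ησ²h] = σ²hψ(1+σ²hη)/(1+σ²h(ψ+η))` holds. -/
theorem HM_golden_parachute_threshold
    (h σ ψ η β : ℝ) (hh : 0 < h) (hσ : 0 < σ) (hψ : 0 < ψ) (hη : 0 < η)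
    (hβ : β ∈ Set.Icc (0:ℝ) 1) :
    (0 ≤ η * σ ^ 2 * h - (σ ^ 2 * h * η + 1) ^ 2 / (σ ^ 2 * h * (ψ + η) + 1)
          - β * (β - 2)
      ↔ 1 - Real.sqrt (σ ^ 2 * h * ψ * (1 + σ ^ 2 * h * η)
            / (1 + σ ^ 2 * h * (ψ + η))) ≤ β) ∧
    1 - ((σ ^ 2 * h * η + 1) ^ 2 / (σ ^ 2 * h * (ψ + η) + 1) - η * σ ^ 2 * h)
      = σ ^ 2 * h * ψ * (1 + σ ^ 2 * h * η) / (1 + σ ^ 2 * h * (ψ + η)) := by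
  have hdisc : 1 - ((σ ^ 2 * h * η + 1) ^ 2 / (σ ^ 2 * h * (ψ + η) + 1) - η * σ ^ 2 * h)
      = σ ^ 2 * h * ψ * (1 + σ ^ 2 * h * η) / (1 + σ ^ 2 * h * (ψ + η)) := by
    rw [add_comm (σ ^ 2 * h * (ψ + η)) 1]
    field_simp
    ring
  refine ⟨?_, hdisc⟩
  rw [sub_le_comm, Real.le_sqrt (sub_nonneg.2 hβ.2) (by positivity), ← hdisc]
  constructor <;> intro H <;> linarith
end
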